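/- arXiv:2110.15781 — 7 statements merged into one kernel-verified Lean document; each statement's English description precedes it below -/
import Mathlib

section
/- Let n ∈ ℕ, let Φ : ℝ → ℝ be strictly increasing and strictly concave, and let u, u' ∈ ℝ^n. If u Lorenz-dominates u' (u ≻_L u'), then ∑_{i=1}^n Φ(u_i) > ∑_{i=1}^n Φ(u'_i). In particular, the additive welfare function F(u) = ∑_{i=1}^n Φ(u_i) is strictly monotone with respect to generalized Lorenz dominance. -/
/-- The generalized Lorenz vector: `lorenz u i` is the sum of the `i+1` smallest
coordinates of `u` (cumulative sums of the nondecreasing rearrangement of `u`). -/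
noncomputable def lorenz {d : ℕ} (u : Fin d → ℝ) (i : Fin d) : ℝ :=
  ∑ j ∈ Finset.Iic i, u (Tuple.sort u j)

/-- Pareto dominance: `u ≻_P u'`. -/
def ParetoDom {d : ℕ} (u u' : Fin d → ℝ) : Prop :=
  (∀ i, u' i ≤ u i) ∧ ∃ i, u' i < u i

/-- (Generalized) Lorenz dominance: `u ≻_L u'`. -/
def LorenzDom {d : ℕ} (u u' : Fin d → ℝ) : Prop :=
  ParetoDom (lorenz u) (lorenz u')

/-- Weak (generalized) Lorenz dominance: `u ⪰_L u'`. -/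
def WeakLorenzDom {d : ℕ} (u u' : Fin d → ℝ) : Prop :=
  ∀ i, lorenz u' i ≤ lorenz u i

/-- A concave function on the line has a supporting line from above at every point. -/
theorem ConcaveOn.exists_forall_le_add_mul {f : ℝ → ℝ} (hf : ConcaveOn ℝ Set.univ f) (a : ℝ) :
    ∃ s, ∀ x, f x ≤ f a + s * (x - a) := by
  set R : Set ℝ := (fun z => (f z - f a) / (z - a)) '' Set.Ioi a
  have hub : ∀ x < a, (f a - f x) / (a - x) ∈ upperBounds R := by
    rintro x hx _ ⟨z, hz, rfl⟩
    exact hf.slope_anti_adjacent (Set.mem_univ x) (Set.mem_univ z) hx hz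
  have hne : R.Nonempty := ⟨_, a + 1, lt_add_one a, rfl⟩
  have hbdd : BddAbove R := ⟨_, hub (a - 1) (sub_one_lt a)⟩
  refine ⟨sSup R, fun x => ?_⟩
  rcases lt_trichotomy x a with hx | rfl | hx
  · have h := csSup_le hne (hub x hx)
    rw [le_div_iff₀ (sub_pos.2 hx)] at h
    linarith
  · simp
  · have h := le_csSup hbdd ⟨x, hx, rfl⟩
    rw [div_le_iff₀ (sub_pos.2 hx)] at h
    linarith

/-- A supporting line of a strictly concave function touches its graph only once. -/
theorem StrictConcaveOn.lt_add_mul_of_forall_le {f : ℝ → ℝ}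
    (hf : StrictConcaveOn ℝ Set.univ f) {a s x : ℝ}
    (h : ∀ y, f y ≤ f a + s * (y - a)) (hx : x ≠ a) : f x < f a + s * (x - a) := by
  have h₁ := hf.2 (Set.mem_univ x) (Set.mem_univ a) hx
    (show (0 : ℝ) < 1 / 2 by norm_num) (show (0 : ℝ) < 1 / 2 by norm_num) (by norm_num)
  have h₂ := h ((1 / 2 : ℝ) • x + (1 / 2 : ℝ) • a)
  simp only [smul_eq_mul] at h₁ h₂
  linarith

/-- Nonnegative nonincreasing weights preserve nonpositivity of partial sums. -/
theorem Fin.sum_mul_nonpos_of_antitone {n : ℕ} {c d : Fin n → ℝ} (hc : Antitone c)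
    (hc₀ : ∀ i, 0 ≤ c i) (hd : ∀ i, ∑ j ∈ Finset.Iic i, d j ≤ 0) : ∑ i, c i * d i ≤ 0 := by
  induction n with
  | zero => simp
  | succ n ih =>
    have h₁ : ∑ i : Fin n, (c i.castSucc - c (Fin.last n)) * d i.castSucc ≤ 0 := by
      refine ih (fun i j hij => ?_) (fun i => ?_) (fun i => ?_)
      · exact sub_le_sub_right (hc (Fin.castSucc_le_castSucc_iff.2 hij)) _
      · exact sub_nonneg.2 (hc (Fin.le_last _))
      · simpa only [Fin.sum_Iic_castSucc] using hd i.castSucc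
    have h₂ : ∑ i, d i ≤ 0 := by
      have h := hd (Fin.last n)
      rwa [← Fin.top_eq_last, Finset.Iic_top] at h
    have h₃ := mul_nonpos_of_nonneg_of_nonpos (hc₀ (Fin.last n)) h₂
    rw [Fin.sum_univ_castSucc] at h₃ ⊢
    simp only [sub_mul, Finset.sum_sub_distrib, ← Finset.mul_sum] at h₁
    linarith

/-- A weak majorization inequality: for nondecreasing `a`, larger partial sums give a strictly
larger sum of values of a strictly increasing, strictly concave function. -/
theorem StrictConcaveOn.sum_lt_sum_of_sum_Iic_le {n : ℕ} {f : ℝ → ℝ} (hmono : StrictMono f)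
    (hf : StrictConcaveOn ℝ Set.univ f) {a b : Fin n → ℝ} (ha : Monotone a) (hab : b ≠ a)
    (h : ∀ i, ∑ j ∈ Finset.Iic i, b j ≤ ∑ j ∈ Finset.Iic i, a j) :
    ∑ i, f (b i) < ∑ i, f (a i) := by
  choose s hs using hf.concaveOn.exists_forall_le_add_mul
  have hs_anti : Antitone s := by
    intro x y hxy
    rcases hxy.eq_or_lt with rfl | hxy
    · exact le_rfl
    · have h₁ := hs x y
      have h₂ := hs y x
      exact le_of_mul_le_mul_right (by linarith) (sub_pos.2 hxy)
  have hs_nonneg : ∀ x, 0 ≤ s x := by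
    intro x
    have h₁ := hs x (x + 1)
    have h₂ := hmono (lt_add_one x)
    linarith
  obtain ⟨k, hk⟩ := Function.ne_iff.1 hab
  have hlt : ∑ i, f (b i) < ∑ i, (f (a i) + s (a i) * (b i - a i)) :=
    Finset.sum_lt_sum (fun i _ => hs (a i) (b i))
      ⟨k, Finset.mem_univ k, hf.lt_add_mul_of_forall_le (hs (a k)) hk⟩
  have hle : ∑ i, s (a i) * (b i - a i) ≤ 0 := by
    refine Fin.sum_mul_nonpos_of_antitone (hs_anti.comp_monotone ha)
      (fun i => hs_nonneg (a i)) (fun i => ?_)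
    rw [Finset.sum_sub_distrib]
    exact sub_nonpos.2 (h i)
  rw [Finset.sum_add_distrib] at hlt
  linarith

/-- additive welfare with a strictly increasing, strictly concave `Φ`
is strictly monotone with respect to generalized Lorenz dominance. -/
theorem additive_welfare_strict_mono_lorenz {n : ℕ} (Φ : ℝ → ℝ)
    (hΦmono : StrictMono Φ) (hΦconc : StrictConcaveOn ℝ Set.univ Φ)
    (u u' : Fin n → ℝ) (h : LorenzDom u u') :
    ∑ i, Φ (u' i) < ∑ i, Φ (u i) := by
  obtain ⟨hle, k, hk⟩ := h
  have hne : u' ∘ Tuple.sort u' ≠ u ∘ Tuple.sort u := fun heq =>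
    hk.ne (Finset.sum_congr rfl fun j _ => congrFun heq j)
  have hlt := hΦconc.sum_lt_sum_of_sum_Iic_le hΦmono (Tuple.monotone_sort u) hne hle
  simpa only [Function.comp_apply, Equiv.sum_comp (Tuple.sort u) fun i => Φ (u i),
    Equiv.sum_comp (Tuple.sort u') fun i => Φ (u' i)] using hlt
end

section
/- For every n ∈ ℕ and all u, u' ∈ ℝ^n, if u Pareto-dominates u' (u ≻_P u'), then u Lorenz-dominates u' (u ≻_L u'); that is, Pareto-dominance implies generalized Lorenz dominance. -/
theorem card_filter_apply_sort_le {α : Type*} [LinearOrder α] {n : ℕ} (f : Fin n → α) (a : α) :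
    (Finset.univ.filter fun i => f (Tuple.sort f i) ≤ a).card =
      (Finset.univ.filter fun i => f i ≤ a).card :=
  Finset.card_equiv (Tuple.sort f) (by simp)

/-- Sorting is monotone: a pointwise inequality passes to the nondecreasing rearrangements. -/
theorem apply_sort_le_apply_sort {α : Type*} [LinearOrder α] {n : ℕ} {f g : Fin n → α}
    (h : ∀ i, f i ≤ g i) (j : Fin n) : f (Tuple.sort f j) ≤ g (Tuple.sort g j) := by
  have hg := (Tuple.lt_card_le_iff_apply_le_of_monotone (j := j) (a := g (Tuple.sort g j))
    (Tuple.monotone_sort g)).2 le_rfl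
  refine (Tuple.lt_card_le_iff_apply_le_of_monotone (Tuple.monotone_sort f)).1 ?_
  simp only [Function.comp_apply, card_filter_apply_sort_le] at hg ⊢
  exact hg.trans_le
    (Finset.card_le_card (Finset.monotone_filter_right _ fun i _ hi => (h i).trans hi))

theorem lorenz_last {m : ℕ} (u : Fin (m + 1) → ℝ) : lorenz u (Fin.last m) = ∑ i, u i := by
  rw [lorenz, ← Fin.top_eq_last, Finset.Iic_top]
  exact Equiv.sum_comp (Tuple.sort u) u

/-- Pareto dominance implies generalized Lorenz dominance. -/
theorem paretoDom_imp_lorenzDom {n : ℕ} (u u' : Fin n → ℝ)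
    (h : ParetoDom u u') : LorenzDom u u' := by
  obtain ⟨hle, k, hk⟩ := h
  refine ⟨fun i => Finset.sum_le_sum fun j _ => apply_sort_le_apply_sort hle j, ?_⟩
  cases n with
  | zero => exact k.elim0
  | succ m =>
    refine ⟨Fin.last m, ?_⟩
    rw [lorenz_last, lorenz_last]
    exact Finset.sum_lt_sum (fun i _ => hle i) ⟨k, Finset.mem_univ k, hk⟩
end

section
/- (Proposition 2) For every d ∈ ℕ with d ≥ 1 and every N ∈ ℕ with N ≥ 1, there is a one-sided recommendation setting with p = d+1 items and m = N(d+1) users (i.e., a choice of exposure weights v and preferences μ) such that for every θ ∈ Θ and every maximizer u^θ of W_θ over 𝒰: (i) there exists β > 0 such that for every u^{qua,β} maximizing F^qua_β over 𝒰, one has u^θ_𝒩 ≻_L u^{qua,β}_𝒩 and u^θ_ℐ ≻_L u^{qua,β}_ℐ; and (ii) for every selection β ↦ u^{qua,β} of maximizers of F^qua_β over 𝒰, the limit L(d) = lim_{β→∞} (∑_{i∈𝒩} u^{qua,β}_i)/(∑_{i∈𝒩} u^θ_i) exists, is independent of the selection and of θ, and L(d) → 5/6 as d → ∞ (for the family of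 settings indexed by d with N fixed). -/
/-- `ψ(x, α)`, extended-real valued, with the conventions `ψ(0,α) = 0` for `α > 0`
and `ψ(0,α) = -∞` for `α ≤ 0`. -/
noncomputable def psi (x α : ℝ) : EReal :=
  if 0 < α then ((x ^ α : ℝ) : EReal)
  else if x = 0 then (⊥ : EReal)
  else if α = 0 then ((Real.log x : ℝ) : EReal)
  else ((-(x ^ α) : ℝ) : EReal)

/-- A `p × p` doubly stochastic matrix. -/
def DoublyStochastic {p : ℕ} (M : Fin p → Fin p → ℝ) : Prop :=
  (∀ j k, 0 ≤ M j k) ∧ (∀ j, ∑ k, M j k = 1) ∧ (∀ k, ∑ j, M j k = 1)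

/-- The set `𝒫` of ranking tensors: one doubly stochastic matrix per user.
`P i j k` is the probability that item `j` is shown to user `i` at rank `k`. -/
def RankingTensors (m p : ℕ) : Set (Fin m → Fin p → Fin p → ℝ) :=
  {P | ∀ i, DoublyStochastic (P i)}

/-- User-side utility `u_i(P) = ∑_j μ_{ij} ∑_k P_{ijk} v_k`. -/
def userUtil {m p : ℕ} (μ : Fin m → Fin p → ℝ) (v : Fin p → ℝ)
    (P : Fin m → Fin p → Fin p → ℝ) (i : Fin m) : ℝ :=
  ∑ j, μ i j * ∑ k, P i j k * v k

/-- Item-side utility (exposure) `u_j(P) = ∑_i ∑_k P_{ijk} v_k`. -/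
def itemUtil {m p : ℕ} (v : Fin p → ℝ)
    (P : Fin m → Fin p → Fin p → ℝ) (j : Fin p) : ℝ :=
  ∑ i, ∑ k, P i j k * v k

/-- The welfare function
`W_θ(u) = (1-λ) ∑_{i ∈ 𝒩} ψ(u_i, α₁) + λ ∑_{j ∈ ℐ} ψ(u_j, α₂)`. -/
noncomputable def welfare {m p : ℕ} (lam a1 a2 : ℝ)
    (uN : Fin m → ℝ) (uI : Fin p → ℝ) : EReal :=
  ((1 - lam : ℝ) : EReal) * ∑ i, psi (uN i) a1 + ((lam : ℝ) : EReal) * ∑ j, psi (uI j) a2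

/-- The quality-weighted-exposure objective
`F^qua_β(u) = ∑_{i∈𝒩} u_i - β √(D^qua(u))` where
`D^qua(u) = (1/n) ∑_{j∈ℐ} (u_j - q_j E / Q)²`, with `q_j = ∑_i μ_{ij}`,
`E = m ‖v‖₁` and `Q = ∑_j q_j`. -/
noncomputable def Fqua {m p : ℕ} (μ : Fin m → Fin p → ℝ) (v : Fin p → ℝ) (β : ℝ)
    (uN : Fin m → ℝ) (uI : Fin p → ℝ) : ℝ :=
  (∑ i, uN i) - β * Real.sqrt ((1 / (m + p : ℝ)) *
    ∑ j, (uI j - (∑ i, μ i j) * ((m : ℝ) * ∑ k, |v k|) / (∑ j', ∑ i, μ i j')) ^ 2)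

/-- Lorenz curves lie below the chord of any upper bound on the total. -/
theorem lorenz_le_sum_const {n : ℕ} (u : Fin n → ℝ) (c : ℝ) (hsum : ∑ i, u i ≤ n * c) (i : Fin n) :
    lorenz u i ≤ ∑ _j ∈ Finset.Iic i, c := by
  have hmono : Monotone (u ∘ Tuple.sort u) := Tuple.monotone_sort u
  have htotal : ∑ j, u (Tuple.sort u j) ≤ n * c := by
    rwa [Equiv.sum_comp (Tuple.sort u) u]
  unfold lorenz
  by_cases hi : u (Tuple.sort u i) ≤ c
  · exact Finset.sum_le_sum fun j hj => (hmono (Finset.mem_Iic.1 hj)).trans hi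
  · push Not at hi
    have hsplit := Finset.sum_add_sum_compl (Finset.Iic i) fun j => u (Tuple.sort u j)
    have hconst := Finset.sum_add_sum_compl (Finset.Iic i) fun _ : Fin n => c
    have htail : ∑ _j ∈ (Finset.Iic i)ᶜ, c ≤ ∑ j ∈ (Finset.Iic i)ᶜ, u (Tuple.sort u j) :=
      Finset.sum_le_sum fun j hj => hi.le.trans <| hmono <| by
        have : ¬ j ≤ i := by simpa using hj
        exact (not_le.1 this).le
    have hcard : ∑ _j : Fin n, c = n * c := by simp
    linarith

/-- A constant profile strictly Lorenz-dominates every other profile with at most the same total. -/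
theorem lorenzDom_const {n : ℕ} (u : Fin n → ℝ) (c : ℝ) (hsum : ∑ i, u i ≤ n * c)
    (hne : ∃ i, u i ≠ c) : LorenzDom (fun _ => c) u := by
  refine ⟨lorenz_le_sum_const u c hsum, ?_⟩
  obtain ⟨i, hi⟩ := hne
  let i₀ : Fin n := ⟨0, i.pos⟩
  have hIic : Finset.Iic i₀ = {i₀} := by
    ext j
    simp only [Finset.mem_Iic, Finset.mem_singleton, Fin.le_def, Fin.ext_iff, i₀]
    omega
  refine ⟨i₀, ?_⟩
  simp only [lorenz, hIic, Finset.sum_singleton]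
  by_contra! hle
  have hge : ∀ j, c ≤ u j := fun j => by
    have h₀ : i₀ ≤ (Tuple.sort u).symm j := Nat.zero_le _
    simpa using hle.trans (Tuple.monotone_sort u h₀)
  have hlt : ∑ _j : Fin n, c < ∑ j, u j :=
    Finset.sum_lt_sum (fun j _ => hge j) ⟨i, Finset.mem_univ i, lt_of_le_of_ne (hge i) hi.symm⟩
  simp only [Finset.sum_const, Finset.card_univ, Fintype.card_fin, nsmul_eq_mul] at hlt
  linarith

/-- `psi · a` lies below its tangent lines. -/
theorem exists_psi_le_tangent {a c : ℝ} (ha : a < 1) (hc : 0 < c) :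
    ∃ r s : ℝ, psi c a = r ∧ ∀ x, 0 ≤ x → psi x a ≤ ((r + s * (x - c) : ℝ) : EReal) := by
  have hquot : ∀ {x : ℝ}, 0 ≤ x → x ^ a = c ^ a * (x / c) ^ a := fun {x} hx => by
    rw [← Real.mul_rpow hc.le (div_nonneg hx hc.le), mul_div_cancel₀ _ hc.ne']
  have hca : 0 < c ^ a := Real.rpow_pos_of_pos hc a
  rcases lt_trichotomy a 0 with ha₀ | rfl | ha₀
  · refine ⟨-(c ^ a), -(c ^ a * (a / c)), by simp [psi, ha₀.not_gt, hc.ne', ha₀.ne], fun x hx => ?_⟩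
    simp only [psi, ha₀.not_gt, if_false, ha₀.ne]
    split_ifs with hx₀
    · exact bot_le
    have hxc : 0 < x / c := div_pos (lt_of_le_of_ne hx (Ne.symm hx₀)) hc
    have hexp : 1 + a * (x / c - 1) ≤ (x / c) ^ a := by
      rw [Real.rpow_def_of_pos hxc]
      have h₁ := Real.add_one_le_exp (Real.log (x / c) * a)
      have h₂ := Real.log_le_sub_one_of_pos hxc
      nlinarith
    rw [EReal.coe_le_coe_iff, hquot hx]
    have hscaled := mul_le_mul_of_nonneg_left hexp hca.le
    have hring : c ^ a * (a / c) * (x - c) = c ^ a * (a * (x / c - 1)) := by field_simp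
    linarith
  · refine ⟨Real.log c, 1 / c, by simp [psi, hc.ne'], fun x hx => ?_⟩
    simp only [psi, lt_irrefl, if_false]
    split_ifs with hx₀
    · exact bot_le
    have hxpos : 0 < x := lt_of_le_of_ne hx (Ne.symm hx₀)
    have hlog := Real.log_le_sub_one_of_pos (div_pos hxpos hc)
    rw [Real.log_div hx₀ hc.ne'] at hlog
    rw [EReal.coe_le_coe_iff]
    have hring : 1 / c * (x - c) = x / c - 1 := by field_simp
    linarith
  · refine ⟨c ^ a, c ^ a * (a / c), by simp [psi, ha₀], fun x hx => ?_⟩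
    have hbern := rpow_one_add_le_one_add_mul_self (s := x / c - 1)
      (by linarith [div_nonneg hx hc.le]) ha₀.le ha.le
    rw [add_sub_cancel] at hbern
    simp only [psi, ha₀, if_true]
    rw [EReal.coe_le_coe_iff, hquot hx]
    have hscaled := mul_le_mul_of_nonneg_left hbern hca.le
    have hring : c ^ a * (a / c) * (x - c) = c ^ a * (a * (x / c - 1)) := by field_simp
    linarith

theorem psi_lt_psi_one {x : ℝ} (a : ℝ) (hx₀ : 0 ≤ x) (hx₁ : x < 1) : psi x a < psi 1 a := by
  rcases lt_trichotomy a 0 with ha | rfl | ha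
  · simp only [psi, ha.not_gt, if_false, ha.ne, one_ne_zero]
    split_ifs with hx
    · exact EReal.bot_lt_coe _
    · have := Real.one_lt_rpow_of_pos_of_lt_one_of_neg (lt_of_le_of_ne hx₀ (Ne.symm hx)) hx₁ ha
      rw [EReal.coe_lt_coe_iff, Real.one_rpow]
      linarith
  · simp only [psi, lt_irrefl, if_false, if_true, one_ne_zero]
    split_ifs with hx
    · exact EReal.bot_lt_coe _
    · rw [EReal.coe_lt_coe_iff, Real.log_one]
      exact Real.log_neg (lt_of_le_of_ne hx₀ (Ne.symm hx)) hx₁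
  · simp only [psi, ha, if_true]
    rw [EReal.coe_lt_coe_iff, Real.one_rpow]
    exact Real.rpow_lt_one hx₀ hx₁ ha

theorem EReal.coe_sum_fin {n : ℕ} (f : Fin n → ℝ) :
    ((∑ i, f i : ℝ) : EReal) = ∑ i, (f i : EReal) :=
  map_sum (⟨⟨Real.toEReal, EReal.coe_zero⟩, EReal.coe_add⟩ : ℝ →+ EReal) f Finset.univ

/-- If all users can get utility `1`, the largest possible, under equal exposures, then every
profile leaving some user below `1` has smaller welfare. -/
theorem welfare_lt_welfare_const {m p : ℕ} {lam a1 a2 c : ℝ} (hlam₀ : 0 < lam) (hlam₁ : lam < 1)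
    (ha2 : a2 < 1) (hc : 0 < c) {uN : Fin m → ℝ} {uI : Fin p → ℝ}
    (huN₀ : ∀ i, 0 ≤ uN i) (huN₁ : ∀ i, uN i ≤ 1) (huI : ∀ j, 0 ≤ uI j)
    (hsum : ∑ j, uI j = p * c) {i₀ : Fin m} (hi₀ : uN i₀ < 1) :
    welfare lam a1 a2 uN uI <
      welfare lam a1 a2 (fun _ : Fin m => (1 : ℝ)) (fun _ : Fin p => c) := by
  obtain ⟨r₂, s, hr₂, htangent⟩ := exists_psi_le_tangent ha2 hc
  obtain ⟨r₁, hr₁⟩ : ∃ r : ℝ, psi 1 a1 = r := by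
    unfold psi
    split_ifs <;> first | exact ⟨_, rfl⟩ | simp_all
  obtain ⟨t, hlt, htr⟩ := EReal.lt_iff_exists_real_btwn.1 (psi_lt_psi_one a1 (huN₀ i₀) hi₀)
  rw [hr₁, EReal.coe_lt_coe_iff] at htr
  have husers : ∑ i, psi (uN i) a1 ≤ ((∑ i, if i = i₀ then t else r₁ : ℝ) : EReal) := by
    rw [EReal.coe_sum_fin]
    refine Finset.sum_le_sum fun i _ => ?_
    split_ifs with hi
    · exact hi ▸ hlt.le
    · rw [← hr₁]
      rcases (huN₁ i).lt_or_eq with h | h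
      · exact (psi_lt_psi_one a1 (huN₀ i) h).le
      · rw [h]
  have hitems : ∑ j, psi (uI j) a2 ≤ ((∑ _j : Fin p, r₂ : ℝ) : EReal) := by
    have hlin : (∑ _j : Fin p, r₂ : ℝ) = ∑ j, (r₂ + s * (uI j - c)) := by
      rw [Finset.sum_add_distrib, ← Finset.mul_sum, Finset.sum_sub_distrib, hsum]
      simp
    rw [hlin, EReal.coe_sum_fin]
    exact Finset.sum_le_sum fun j _ => htangent _ (huI j)
  have hreal : (∑ i, if i = i₀ then t else r₁) < ∑ _i : Fin m, r₁ :=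
    Finset.sum_lt_sum (fun i _ => by split_ifs <;> linarith) ⟨i₀, Finset.mem_univ _, by simpa⟩
  simp only [welfare]
  rw [hr₁, hr₂, ← EReal.coe_sum_fin, ← EReal.coe_sum_fin, ← EReal.coe_mul, ← EReal.coe_mul,
    ← EReal.coe_add]
  refine (add_le_add (mul_le_mul_of_nonneg_left husers (EReal.coe_nonneg.2 (by linarith)))
    (mul_le_mul_of_nonneg_left hitems (EReal.coe_nonneg.2 hlam₀.le))).trans_lt ?_
  rw [← EReal.coe_mul, ← EReal.coe_mul, ← EReal.coe_add, EReal.coe_lt_coe_iff]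
  have := mul_lt_mul_of_pos_left hreal (sub_pos.2 hlam₁)
  linarith

theorem sum_modNat {N p : ℕ} (f : Fin p → ℝ) :
    ∑ i : Fin (N * p), f i.modNat = N * ∑ g, f g := by
  rw [← (finProdFinEquiv (m := N) (n := p)).sum_comp, Fintype.sum_prod_type]
  have hmod : ∀ (x : Fin N) (y : Fin p), (finProdFinEquiv (x, y)).modNat = y := fun x y =>
    congrArg Prod.snd (finProdFinEquiv.symm_apply_apply (x, y))
  simp [hmod]

/-- Exposure weights giving all the attention to the first rank. -/
def topWeight (d : ℕ) (k : Fin (d + 1)) : ℝ := if k = 0 then 1 else 0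

/-- The value of item `j` for a user of type `g`: users prefer the item of their own type, and
item `0` is everyone's second choice. -/
noncomputable def groupPref (d : ℕ) (g j : Fin (d + 1)) : ℝ :=
  if j = g then 1 else if j = 0 then 1 / 2 else 0

/-- Preferences of a population with `N` users of each type. -/
noncomputable def userPref (N d : ℕ) (i : Fin (N * (d + 1))) (j : Fin (d + 1)) : ℝ :=
  groupPref d i.modNat j

/-- The ranking showing to each user, at the first rank, the item of her own type with
probability `y` and item `0` otherwise. -/
noncomputable def mixRanking (N d : ℕ) (y : ℝ) (i : Fin (N * (d + 1))) (j k : Fin (d + 1)) : ℝ :=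
  y * (if Equiv.swap 0 i.modNat k = j then 1 else 0) + (1 - y) * (if k = j then 1 else 0)

theorem sum_mul_topWeight {d : ℕ} (f : Fin (d + 1) → ℝ) : ∑ k, f k * topWeight d k = f 0 := by
  simp [topWeight]

theorem userUtil_topWeight {N d : ℕ} (P : Fin (N * (d + 1)) → Fin (d + 1) → Fin (d + 1) → ℝ)
    (i : Fin (N * (d + 1))) :
    userUtil (userPref N d) (topWeight d) P i = ∑ j, groupPref d i.modNat j * P i j 0 := by
  simp only [userUtil, sum_mul_topWeight, userPref]

theorem itemUtil_topWeight {N d : ℕ} (P : Fin (N * (d + 1)) → Fin (d + 1) → Fin (d + 1) → ℝ)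
    (j : Fin (d + 1)) : itemUtil (topWeight d) P j = ∑ i, P i j 0 := by
  simp only [itemUtil, sum_mul_topWeight]

theorem groupPref_nonneg {d : ℕ} (g j : Fin (d + 1)) : 0 ≤ groupPref d g j := by
  unfold groupPref; split_ifs <;> norm_num

theorem groupPref_le_one {d : ℕ} (g j : Fin (d + 1)) : groupPref d g j ≤ 1 := by
  unfold groupPref; split_ifs <;> norm_num

theorem mixRanking_mem {N d : ℕ} {y : ℝ} (hy₀ : 0 ≤ y) (hy₁ : y ≤ 1) :
    mixRanking N d y ∈ RankingTensors (N * (d + 1)) (d + 1) := by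
  refine fun i => ⟨fun j k => ?_, fun j => ?_, fun k => ?_⟩
  · have := sub_nonneg.2 hy₁
    unfold mixRanking
    positivity
  · have hswap : ∀ k, (Equiv.swap 0 i.modNat k = j) = (k = Equiv.swap 0 i.modNat j) :=
      fun k => propext (Equiv.swap_apply_eq_iff)
    simp [mixRanking, Finset.sum_add_distrib, hswap]
  · simp [mixRanking, Finset.sum_add_distrib]

theorem mixRanking_zero {N d : ℕ} (y : ℝ) (i : Fin (N * (d + 1))) (j : Fin (d + 1)) :
    mixRanking N d y i j 0 = y * (if i.modNat = j then 1 else 0) +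
      (1 - y) * (if 0 = j then 1 else 0) := by
  simp [mixRanking]

theorem userUtil_mixRanking {N d : ℕ} (y : ℝ) (i : Fin (N * (d + 1))) :
    userUtil (userPref N d) (topWeight d) (mixRanking N d y) i =
      y + (1 - y) * groupPref d i.modNat 0 := by
  rw [userUtil_topWeight]
  have hself : groupPref d i.modNat i.modNat = 1 := if_pos rfl
  simp only [mixRanking_zero, mul_add, Finset.sum_add_distrib]
  simp [hself, mul_comm]

theorem itemUtil_mixRanking {N d : ℕ} (y : ℝ) (j : Fin (d + 1)) :
    itemUtil (topWeight d) (mixRanking N d y) j =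
      N * (y + (1 - y) * (if 0 = j then (d + 1 : ℝ) else 0)) := by
  rw [itemUtil_topWeight]
  simp only [mixRanking_zero]
  rw [sum_modNat fun g => y * (if g = j then 1 else 0) + (1 - y) * (if 0 = j then 1 else 0)]
  rw [Finset.sum_add_distrib, ← Finset.mul_sum]
  split_ifs
  · simp
    exact Or.inl (by ring)
  · simp [mul_comm]

theorem sum_groupPref {d : ℕ} (j : Fin (d + 1)) :
    ∑ g, groupPref d g j = if j = 0 then 1 + (d : ℝ) / 2 else 1 := by
  split_ifs with hj
  · subst hj
    simp [Fin.sum_univ_succ, groupPref, (Fin.succ_ne_zero _).symm, div_eq_mul_inv]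
  · simp [groupPref, hj]

/-- The total user utility under the best ranking with quality-weighted exposures is
`limitRatio d` times the number of users. -/
noncomputable def limitRatio (d : ℕ) : ℝ :=
  1 + 1 / (2 * (d + 1)) - (d + 2) / (2 * (3 * d + 2))

/-- The quality-weighted exposure of item `0` is the largest one. -/
noncomputable def qualityTarget (N d : ℕ) (j : Fin (d + 1)) : ℝ :=
  if j = 0 then N * (d + 1) * (d + 2) / (3 * d + 2) else N * (2 * (d + 1)) / (3 * d + 2)

theorem sum_userPref (N d : ℕ) (j : Fin (d + 1)) :
    ∑ i, userPref N d i j = N * if j = 0 then 1 + (d : ℝ) / 2 else 1 := by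
  rw [← sum_groupPref]
  exact sum_modNat fun g => groupPref d g j

theorem qualityTarget_eq {N d : ℕ} (hN : 1 ≤ N) (j : Fin (d + 1)) :
    (∑ i, userPref N d i j) * (((N * (d + 1) : ℕ) : ℝ) * ∑ k, |topWeight d k|) /
      (∑ j', ∑ i, userPref N d i j') = qualityTarget N d j := by
  have hv : ∑ k, |topWeight d k| = 1 := by
    simp [topWeight, apply_ite abs]
  have hQ : ∑ j', ∑ i, userPref N d i j' = N * (3 * d + 2) / 2 := by
    simp only [sum_userPref, ← Finset.mul_sum, Fin.sum_univ_succ]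
    simp [Fin.succ_ne_zero]
    ring
  have hN' : (N : ℝ) ≠ 0 := by positivity
  rw [hv, hQ, sum_userPref, qualityTarget]
  have hd : (3 * d + 2 : ℝ) ≠ 0 := by positivity
  split_ifs <;> push_cast <;> field_simp
  ring

theorem Fqua_userPref {N d : ℕ} (hN : 1 ≤ N) (β : ℝ) (uN : Fin (N * (d + 1)) → ℝ)
    (uI : Fin (d + 1) → ℝ) :
    Fqua (userPref N d) (topWeight d) β uN uI = (∑ i, uN i) - β * Real.sqrt
      ((1 / (((N * (d + 1) : ℕ) : ℝ) + ((d + 1 : ℕ) : ℝ))) *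
        ∑ j, (uI j - qualityTarget N d j) ^ 2) := by
  simp only [Fqua, qualityTarget_eq hN]

section Feasible

variable {N d : ℕ} {P : Fin (N * (d + 1)) → Fin (d + 1) → Fin (d + 1) → ℝ}

theorem sum_itemUtil (hP : P ∈ RankingTensors (N * (d + 1)) (d + 1)) :
    ∑ j, itemUtil (topWeight d) P j = (d + 1 : ℕ) * (N : ℝ) := by
  simp only [itemUtil_topWeight]
  rw [Finset.sum_comm, Finset.sum_congr rfl fun i _ => (hP i).2.2 0]
  simp [mul_comm]

theorem itemUtil_nonneg (hP : P ∈ RankingTensors (N * (d + 1)) (d + 1)) (j : Fin (d + 1)) :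
    0 ≤ itemUtil (topWeight d) P j := by
  rw [itemUtil_topWeight]
  exact Finset.sum_nonneg fun i _ => (hP i).1 j 0

theorem userUtil_nonneg (hP : P ∈ RankingTensors (N * (d + 1)) (d + 1))
    (i : Fin (N * (d + 1))) : 0 ≤ userUtil (userPref N d) (topWeight d) P i := by
  rw [userUtil_topWeight]
  exact Finset.sum_nonneg fun j _ => mul_nonneg (groupPref_nonneg _ _) ((hP i).1 j 0)

theorem mul_le_one_sub_userUtil (hP : P ∈ RankingTensors (N * (d + 1)) (d + 1))
    (i : Fin (N * (d + 1))) (j : Fin (d + 1)) :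
    (1 - groupPref d i.modNat j) * P i j 0 ≤
      1 - userUtil (userPref N d) (topWeight d) P i := by
  have hsum : ∑ j, (1 - groupPref d i.modNat j) * P i j 0 =
      1 - userUtil (userPref N d) (topWeight d) P i := by
    simp only [sub_mul, one_mul, Finset.sum_sub_distrib, (hP i).2.2 0, userUtil_topWeight]
  rw [← hsum]
  exact Finset.single_le_sum (f := fun j => (1 - groupPref d i.modNat j) * P i j 0)
    (fun j _ => mul_nonneg (sub_nonneg.2 (groupPref_le_one _ _)) ((hP i).1 j 0))
    (Finset.mem_univ j)

theorem userUtil_le_one (hP : P ∈ RankingTensors (N * (d + 1)) (d + 1))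
    (i : Fin (N * (d + 1))) : userUtil (userPref N d) (topWeight d) P i ≤ 1 := by
  have := mul_le_one_sub_userUtil hP i i.modNat
  simp only [groupPref, if_true, sub_self, zero_mul] at this
  linarith

theorem itemUtil_eq_of_userUtil_eq_one (hP : P ∈ RankingTensors (N * (d + 1)) (d + 1))
    (h : ∀ i, userUtil (userPref N d) (topWeight d) P i = 1) (j : Fin (d + 1)) :
    itemUtil (topWeight d) P j = N := by
  have hoff : ∀ i j, j ≠ i.modNat → P i j 0 = 0 := fun i j hj => by
    have hle := mul_le_one_sub_userUtil hP i j
    have hnonneg := (hP i).1 j 0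
    have hpref : groupPref d i.modNat j ≤ 1 / 2 := by
      simp only [groupPref, hj, if_false]
      split_ifs <;> norm_num
    rw [h i] at hle
    nlinarith
  have hind : ∀ i, P i j 0 = if i.modNat = j then 1 else 0 := fun i => by
    split_ifs with hij
    · have hrow := (hP i).2.2 0
      rwa [Finset.sum_eq_single i.modNat (fun j' _ hj' => hoff i j' hj') (by simp), hij] at hrow
    · exact hoff i j (Ne.symm hij)
  rw [itemUtil_topWeight, Finset.sum_congr rfl fun i _ => hind i,
    sum_modNat fun g => if g = j then (1 : ℝ) else 0]
  simp

/-- Exposing item `0` costs utility to the users whose type is another item. -/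
theorem sum_userUtil_le (hP : P ∈ RankingTensors (N * (d + 1)) (d + 1)) :
    ∑ i, userUtil (userPref N d) (topWeight d) P i ≤
      N * (d + 1) + N / 2 - itemUtil (topWeight d) P 0 / 2 := by
  have hbound : ∀ i, userUtil (userPref N d) (topWeight d) P i ≤
      1 + (if i.modNat = (0 : Fin (d + 1)) then 1 / 2 else 0) - P i 0 0 / 2 := fun i => by
    have hle := mul_le_one_sub_userUtil hP i 0
    have hcol : P i 0 0 ≤ 1 := by
      rw [← (hP i).2.2 0]
      exact Finset.single_le_sum (f := fun j => P i j 0) (fun j _ => (hP i).1 j 0)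
        (Finset.mem_univ 0)
    have hone := userUtil_le_one hP i
    split_ifs with hi
    · linarith
    · simp only [groupPref, Ne.symm hi, if_false, if_true] at hle
      linarith
  refine (Finset.sum_le_sum fun i _ => hbound i).trans_eq ?_
  rw [Finset.sum_sub_distrib, Finset.sum_add_distrib, ← Finset.sum_div, itemUtil_topWeight,
    sum_modNat fun g => if g = (0 : Fin (d + 1)) then (1 / 2 : ℝ) else 0]
  simp [div_eq_mul_inv]

/-- The ranking attaining the quality-weighted exposures at the least cost for the users. -/
theorem exists_ranking_qualityTarget (N d : ℕ) :
    ∃ P ∈ RankingTensors (N * (d + 1)) (d + 1),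
      (∀ j, itemUtil (topWeight d) P j = qualityTarget N d j) ∧
      ∑ i, userUtil (userPref N d) (topWeight d) P i = limitRatio d * (N * (d + 1)) := by
  have hd : (0 : ℝ) < 3 * d + 2 := by positivity
  refine ⟨mixRanking N d (2 * (d + 1) / (3 * d + 2)), mixRanking_mem (by positivity) ?_,
    fun j => ?_, ?_⟩
  · rw [div_le_one hd]
    linarith [Nat.cast_nonneg (α := ℝ) d]
  · rw [itemUtil_mixRanking, qualityTarget]
    simp only [eq_comm (a := (0 : Fin (d + 1)))]
    split_ifs <;> field_simp <;> ring
  · simp only [userUtil_mixRanking]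
    rw [sum_modNat fun g => 2 * (d + 1 : ℝ) / (3 * d + 2) +
      (1 - 2 * (d + 1 : ℝ) / (3 * d + 2)) * groupPref d g 0]
    rw [Finset.sum_add_distrib, ← Finset.mul_sum, sum_groupPref, limitRatio]
    simp
    field_simp
    ring

/-- For a large penalty, maximizers of the penalized objective have exactly the quality-weighted
exposures, and optimal user utility among those. -/
theorem eq_of_maximizes_Fqua (hN : 1 ≤ N) {β : ℝ}
    (hβ : ((N * (d + 1) : ℕ) : ℝ) + ((d + 1 : ℕ) : ℝ) < β)
    (hP : P ∈ RankingTensors (N * (d + 1)) (d + 1))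
    (hmax : ∀ P' ∈ RankingTensors (N * (d + 1)) (d + 1),
      Fqua (userPref N d) (topWeight d) β (userUtil (userPref N d) (topWeight d) P')
          (itemUtil (topWeight d) P') ≤
        Fqua (userPref N d) (topWeight d) β (userUtil (userPref N d) (topWeight d) P)
          (itemUtil (topWeight d) P)) :
    itemUtil (topWeight d) P 0 = qualityTarget N d 0 ∧
      ∑ i, userUtil (userPref N d) (topWeight d) P i = limitRatio d * (N * (d + 1)) := by
  obtain ⟨P', hP', hitem, huser⟩ := exists_ranking_qualityTarget N d
  have hle := hmax P' hP'
  rw [Fqua_userPref hN, Fqua_userPref hN] at hle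
  simp only [hitem, sub_self, huser] at hle
  set n : ℝ := ((N * (d + 1) : ℕ) : ℝ) + ((d + 1 : ℕ) : ℝ)
  have hn1 : 1 ≤ n := by
    have h₁ : (1 : ℝ) ≤ ((d + 1 : ℕ) : ℝ) := by exact_mod_cast Nat.le_add_left 1 d
    have h₂ : (0 : ℝ) ≤ ((N * (d + 1) : ℕ) : ℝ) := Nat.cast_nonneg _
    linarith
  set s := Real.sqrt (1 / n * ∑ j, (itemUtil (topWeight d) P j - qualityTarget N d j) ^ 2)
  have hs₀ : 0 ≤ s := Real.sqrt_nonneg _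
  have hdist : |itemUtil (topWeight d) P 0 - qualityTarget N d 0| ≤ n * s := by
    have hsq : s ^ 2 =
        1 / n * ∑ j, (itemUtil (topWeight d) P j - qualityTarget N d j) ^ 2 :=
      Real.sq_sqrt (by positivity)
    have hterm := Finset.single_le_sum
      (f := fun j => (itemUtil (topWeight d) P j - qualityTarget N d j) ^ 2)
      (fun j _ => sq_nonneg _) (Finset.mem_univ 0)
    have hns : ∑ j, (itemUtil (topWeight d) P j - qualityTarget N d j) ^ 2 = n * s ^ 2 := by
      rw [hsq]; field_simp
    refine abs_le_of_sq_le_sq ?_ (by positivity)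
    refine (hterm.trans_eq hns).trans ?_
    rw [mul_pow]
    exact mul_le_mul_of_nonneg_right (le_self_pow₀ hn1 two_ne_zero) (sq_nonneg s)
  have hupper := sum_userUtil_le hP
  have hratio : limitRatio d * (N * (d + 1)) =
      N * (d + 1) + N / 2 - qualityTarget N d 0 / 2 := by
    simp only [limitRatio, qualityTarget, if_true]
    field_simp
  have hs_zero : s = 0 := by
    have hpenalty : β * s ≤ n * s := by
      simp only [Finset.sum_const_zero, mul_zero, Real.sqrt_zero, sub_zero, ne_eq,
        OfNat.ofNat_ne_zero, not_false_eq_true, zero_pow] at hle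
      linarith [(abs_le.1 hdist).1, mul_nonneg (by linarith : 0 ≤ n) hs₀]
    by_contra hne
    exact hpenalty.not_gt (mul_lt_mul_of_pos_right hβ (lt_of_le_of_ne hs₀ (Ne.symm hne)))
  rw [hs_zero, mul_zero, abs_nonpos_iff, sub_eq_zero] at hdist
  refine ⟨hdist, le_antisymm ?_ ?_⟩
  · rw [hratio, ← hdist]; exact hupper
  · rw [hs_zero] at hle
    simpa using hle

end Feasible

theorem lt_qualityTarget_zero {N d : ℕ} (hN : 1 ≤ N) (hd : 1 ≤ d) :
    (N : ℝ) < qualityTarget N d 0 := by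
  have hN' : (1 : ℝ) ≤ N := by exact_mod_cast hN
  have hd' : (1 : ℝ) ≤ d := by exact_mod_cast hd
  simp only [qualityTarget, if_true]
  rw [lt_div_iff₀ (by positivity)]
  have : (0 : ℝ) < N * (d * d) := by positivity
  nlinarith

theorem tendsto_limitRatio : Filter.Tendsto limitRatio Filter.atTop (nhds (5 / 6 : ℝ)) := by
  have hinv := tendsto_one_div_add_atTop_nhds_zero_nat (𝕜 := ℝ)
  have hlim : Filter.Tendsto (fun d : ℕ => 1 + 1 / 2 * (1 / ((d : ℝ) + 1)) -
      (1 + 1 / ((d : ℝ) + 1)) / (2 * (3 - 1 / ((d : ℝ) + 1)))) Filter.atTop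
      (nhds (1 + 1 / 2 * 0 - (1 + 0) / (2 * (3 - 0)))) :=
    ((hinv.const_mul _).const_add _).sub
      ((hinv.const_add _).div ((hinv.const_sub _).const_mul _) (by norm_num))
  convert hlim using 1
  · ext d
    have h₁ : (d : ℝ) + 1 ≠ 0 := by positivity
    have h₂ : 3 * (d : ℝ) + 2 ≠ 0 := by positivity
    have h₃ : 3 - 1 / ((d : ℝ) + 1) = (3 * d + 2) / (d + 1) := by field_simp; ring
    rw [h₃, limitRatio]
    field_simp
    ring
  · norm_num

/-- Every welfare maximizer gives each user the largest possible utility. -/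
theorem userUtil_eq_one_of_maximizes_welfare {N d : ℕ} (hN : 1 ≤ N) {lam a1 a2 : ℝ}
    (hlam₀ : 0 < lam) (hlam₁ : lam < 1) (ha2 : a2 < 1)
    {P : Fin (N * (d + 1)) → Fin (d + 1) → Fin (d + 1) → ℝ}
    (hP : P ∈ RankingTensors (N * (d + 1)) (d + 1))
    (hmax : ∀ P' ∈ RankingTensors (N * (d + 1)) (d + 1),
      welfare lam a1 a2 (userUtil (userPref N d) (topWeight d) P') (itemUtil (topWeight d) P') ≤
        welfare lam a1 a2 (userUtil (userPref N d) (topWeight d) P) (itemUtil (topWeight d) P))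
    (i : Fin (N * (d + 1))) : userUtil (userPref N d) (topWeight d) P i = 1 := by
  by_contra hi
  have hle := hmax _ (mixRanking_mem zero_le_one le_rfl)
  have huser : userUtil (userPref N d) (topWeight d) (mixRanking N d 1) = fun _ => 1 :=
    funext fun i => by simp [userUtil_mixRanking]
  have hitem : itemUtil (topWeight d) (mixRanking N d 1) = fun _ => (N : ℝ) :=
    funext fun j => by simp [itemUtil_mixRanking]
  rw [huser, hitem] at hle
  exact hle.not_gt <| welfare_lt_welfare_const hlam₀ hlam₁ ha2 (by exact_mod_cast hN)
    (userUtil_nonneg hP) (userUtil_le_one hP) (itemUtil_nonneg hP) (sum_itemUtil hP)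
    (lt_of_le_of_ne (userUtil_le_one hP i) hi)

/-- Proposition 2: there is a family of one-sided recommendation
problems (indexed by `d`, with `p = d+1` items and `m = N(d+1)` users) on which,
compared to any welfare maximizer, quality-weighted exposure produces user and item
profiles that are Lorenz-dominated, and the limit ratio of total user utilities
(as `β → ∞`) exists, is independent of the selection of maximizers and of `θ`,
and converges to `5/6` as `d → ∞`. -/
theorem quality_weighted_unfair (N : ℕ) (hN : 1 ≤ N) :
    ∃ (v : (d : ℕ) → Fin (d + 1) → ℝ)
      (μ : (d : ℕ) → Fin (N * (d + 1)) → Fin (d + 1) → ℝ) (L : ℕ → ℝ),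
      (∀ d : ℕ, 1 ≤ d →
        (∀ k, 0 ≤ v d k) ∧ (∀ k l : Fin (d + 1), k ≤ l → v d l ≤ v d k) ∧
        (∀ i j, 0 ≤ μ d i j) ∧
        (∀ lam a1 a2 : ℝ, 0 < lam → lam < 1 → a1 < 1 → a2 < 1 →
          ∀ Pθ ∈ RankingTensors (N * (d + 1)) (d + 1),
          (∀ P ∈ RankingTensors (N * (d + 1)) (d + 1),
            welfare lam a1 a2 (userUtil (μ d) (v d) P) (itemUtil (v d) P) ≤
              welfare lam a1 a2 (userUtil (μ d) (v d) Pθ) (itemUtil (v d) Pθ)) →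
          -- (i) for some β > 0, any maximizer of F^qua_β is Lorenz-dominated
          -- on both the user side and the item side
          ((∃ β : ℝ, 0 < β ∧
            ∀ Pq ∈ RankingTensors (N * (d + 1)) (d + 1),
              (∀ P ∈ RankingTensors (N * (d + 1)) (d + 1),
                Fqua (μ d) (v d) β (userUtil (μ d) (v d) P) (itemUtil (v d) P) ≤
                  Fqua (μ d) (v d) β (userUtil (μ d) (v d) Pq) (itemUtil (v d) Pq)) →
              LorenzDom (userUtil (μ d) (v d) Pθ) (userUtil (μ d) (v d) Pq) ∧
                LorenzDom (itemUtil (v d) Pθ) (itemUtil (v d) Pq)) ∧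
          -- (ii) for every selection of maximizers of F^qua_β, the ratio of total
          -- user utilities tends to L d as β → ∞
          (∀ sel : ℝ → (Fin (N * (d + 1)) → Fin (d + 1) → Fin (d + 1) → ℝ),
            (∀ β : ℝ, 0 < β →
              sel β ∈ RankingTensors (N * (d + 1)) (d + 1) ∧
              ∀ P ∈ RankingTensors (N * (d + 1)) (d + 1),
                Fqua (μ d) (v d) β (userUtil (μ d) (v d) P) (itemUtil (v d) P) ≤
                  Fqua (μ d) (v d) β (userUtil (μ d) (v d) (sel β))
                    (itemUtil (v d) (sel β))) →
            Filter.Tendsto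
              (fun β => (∑ i, userUtil (μ d) (v d) (sel β) i) /
                (∑ i, userUtil (μ d) (v d) Pθ i))
              Filter.atTop (nhds (L d)))))) ∧
      Filter.Tendsto L Filter.atTop (nhds (5 / 6 : ℝ)) := by
  refine ⟨topWeight, userPref N, limitRatio, fun d hd => ⟨fun k => ?_, fun k l hkl => ?_,
    fun i j => groupPref_nonneg _ _, fun lam a1 a2 hlam₀ hlam₁ _ ha2 Pθ hPθ hmax => ?_⟩,
    tendsto_limitRatio⟩
  · unfold topWeight
    positivity
  · unfold topWeight
    split_ifs with hl hk hk
    · rfl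
    · exact absurd (Fin.le_zero_iff.1 (hl ▸ hkl)) hk
    · exact zero_le_one
    · rfl
  have huser : userUtil (userPref N d) (topWeight d) Pθ = fun _ => 1 :=
    funext <| userUtil_eq_one_of_maximizes_welfare hN hlam₀ hlam₁ ha2 hPθ hmax
  have hitem : itemUtil (topWeight d) Pθ = fun _ => (N : ℝ) :=
    funext <| itemUtil_eq_of_userUtil_eq_one hPθ (congrFun huser)
  refine ⟨⟨((N * (d + 1) : ℕ) : ℝ) + ((d + 1 : ℕ) : ℝ) + 1, by positivity,
    fun Pq hPq hPq_max => ?_⟩, fun sel hsel => ?_⟩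
  · have hexposure := (eq_of_maximizes_Fqua hN (lt_add_one _) hPq hPq_max).1
    have hne : itemUtil (topWeight d) Pq 0 ≠ N :=
      hexposure ▸ (lt_qualityTarget_zero hN hd).ne'
    rw [huser, hitem]
    refine ⟨lorenzDom_const _ _ ?_ ?_, lorenzDom_const _ _ (sum_itemUtil hPq).le ⟨0, hne⟩⟩
    · refine (Finset.sum_le_sum fun i _ => userUtil_le_one hPq i).trans_eq ?_
      simp
    · by_contra! hall
      exact hne (itemUtil_eq_of_userUtil_eq_one hPq hall 0)
  · refine tendsto_const_nhds.congr' ?_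
    filter_upwards [Filter.eventually_gt_atTop
      (((N * (d + 1) : ℕ) : ℝ) + ((d + 1 : ℕ) : ℝ))] with β hβ
    obtain ⟨hmem, hsel_max⟩ := hsel β (lt_of_le_of_lt (by positivity) hβ)
    rw [(eq_of_maximizes_Fqua hN hβ hmem hsel_max).2, huser]
    have hN' : (N : ℝ) ≠ 0 := by positivity
    have hd' : (d : ℝ) + 1 ≠ 0 := by positivity
    simp [hN', hd']
end

section
/- (Ranking rearrangement lemma) Let A be an n×n real matrix, let v ∈ ℝ^p with v_1 ≥ v_2 ≥ … ≥ v_p ≥ 0, and let K be the largest index with v_K > 0 (K = p if no coordinate of v is zero; if v = 0 the claim is trivial). Define the tensor X by X_{ijk} = A_{ij} v_k and ⟨P,X⟩ = ∑_{i,j,k} P_{ijk} X_{ijk}. Suppose P ∈ 𝒫 satisfies: for every user i, every σ ∈ 𝔖(P_i), and all items j, j', if σ(j) ≤ K and σ(j) < σ(j') then A_{ij} ≥ A_{ij'}. Then P ∈ argmax_{P'∈𝒫} ⟨P',X⟩. Conversely, if v_k > v_{k+1} ≥ 0 for all k ∈ {1,…,p−1}, then every P ∈ argmax_{P'∈𝒫}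 ⟨P',X⟩ satisfies: for every user i, every σ ∈ 𝔖(P_i), and all items j, j', σ(j) < σ(j') implies A_{ij} ≥ A_{ij'}. -/
/-- `σ ∈ 𝔖(M)` : the permutation `σ` (mapping items to ranks) is in the support of
the stochastic ranking `M`. -/
def InSupport {p : ℕ} (M : Fin p → Fin p → ℝ) (σ : Equiv.Perm (Fin p)) : Prop :=
  ∀ j, 0 < M j (σ j)

/-- The dot product `⟨P, X⟩` for `X_{ijk} = A_{ij} v_k`. -/
def dotAV {m p : ℕ} (P : Fin m → Fin p → Fin p → ℝ) (A : Fin m → Fin p → ℝ)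
    (v : Fin p → ℝ) : ℝ :=
  ∑ i, ∑ j, ∑ k, P i j k * (A i j * v k)

open Finset

/-- The value of a single ranking matrix `M` for relevances `a` and exposure weights `v`. -/
def rankValue {p : ℕ} (M : Fin p → Fin p → ℝ) (a v : Fin p → ℝ) : ℝ :=
  ∑ j, ∑ k, M j k * (a j * v k)

/-- **Birkhoff's theorem**, in the form of a lottery over permutations. -/
lemma DoublyStochastic.exists_perm_weights {p : ℕ} {M : Fin p → Fin p → ℝ}
    (hM : DoublyStochastic M) :
    ∃ w : Equiv.Perm (Fin p) → ℝ, (∀ σ, 0 ≤ w σ) ∧ ∑ σ, w σ = 1 ∧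
      ∀ j k, M j k = ∑ σ, if σ j = k then w σ else 0 := by
  obtain ⟨w, hw, hsum, hMw⟩ := exists_eq_sum_perm_of_mem_doublyStochastic
    (M := Matrix.of M) (mem_doublyStochastic_iff_sum.2 hM)
  refine ⟨w, hw, hsum, fun j k => ?_⟩
  have h := congrFun (congrFun hMw j) k
  rw [Matrix.of_apply] at h
  rw [← h, Matrix.sum_apply]
  refine sum_congr rfl fun σ _ => ?_
  simp [Equiv.Perm.permMatrix, PEquiv.toMatrix_apply, eq_comm]

lemma rankValue_eq_sum_perm {p : ℕ} {M : Fin p → Fin p → ℝ} {w : Equiv.Perm (Fin p) → ℝ}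
    (hMw : ∀ j k, M j k = ∑ σ, if σ j = k then w σ else 0) (a v : Fin p → ℝ) :
    rankValue M a v = ∑ σ, w σ * ∑ j, a j * v (σ j) := by
  calc rankValue M a v
      = ∑ j, ∑ σ, ∑ k, (if σ j = k then w σ else 0) * (a j * v k) := by
        simp only [rankValue, hMw, sum_mul]
        exact sum_congr rfl fun j _ => sum_comm
    _ = ∑ σ : Equiv.Perm (Fin p), ∑ j, w σ * (a j * v (σ j)) := by
        rw [sum_comm]
        simp [ite_mul]
    _ = _ := by simp only [mul_sum]

lemma inSupport_of_perm_weight_pos {p : ℕ} {M : Fin p → Fin p → ℝ}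
    {w : Equiv.Perm (Fin p) → ℝ} (hw : ∀ σ, 0 ≤ w σ)
    (hMw : ∀ j k, M j k = ∑ σ, if σ j = k then w σ else 0)
    {σ : Equiv.Perm (Fin p)} (hσ : 0 < w σ) : InSupport M σ := by
  intro j
  rw [hMw]
  refine sum_pos' (fun τ _ => ?_) ⟨σ, mem_univ _, by simpa using hσ⟩
  split_ifs
  exacts [hw τ, le_rfl]

/-- If the weights are arranged in the order of the relevances by every permutation in the
support of `M`, then `M` has the largest value among doubly stochastic matrices. -/
lemma rankValue_le_of_forall_monovary {p : ℕ} {M M' : Fin p → Fin p → ℝ} {a v : Fin p → ℝ}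
    (hM : DoublyStochastic M) (hM' : DoublyStochastic M')
    (h : ∀ σ, InSupport M σ → Monovary a (v ∘ σ)) :
    rankValue M' a v ≤ rankValue M a v := by
  obtain ⟨w, hw, hsum, hMw⟩ := hM.exists_perm_weights
  obtain ⟨w', hw', hsum', hMw'⟩ := hM'.exists_perm_weights
  have key : ∀ σ τ : Equiv.Perm (Fin p), 0 < w σ →
      ∑ j, a j * v (τ j) ≤ ∑ j, a j * v (σ j) := by
    intro σ τ hσ
    have := (h σ (inSupport_of_perm_weight_pos hw hMw hσ)).sum_mul_comp_perm_le_sum_mul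
      (σ := σ⁻¹ * τ)
    simpa using this
  rw [rankValue_eq_sum_perm hMw, rankValue_eq_sum_perm hMw']
  calc ∑ τ, w' τ * ∑ j, a j * v (τ j)
      = ∑ σ, w σ * ∑ τ, w' τ * ∑ j, a j * v (τ j) := by rw [← sum_mul, hsum, one_mul]
    _ ≤ ∑ σ, w σ * ∑ j, a j * v (σ j) := by
        refine sum_le_sum fun σ _ => ?_
        rcases (hw σ).eq_or_lt with h0 | hσ
        · simp [← h0]
        · refine mul_le_mul_of_nonneg_left ?_ hσ.le
          calc ∑ τ, w' τ * ∑ j, a j * v (τ j)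
              ≤ ∑ τ, w' τ * ∑ j, a j * v (σ j) :=
                sum_le_sum fun τ _ => mul_le_mul_of_nonneg_left (key σ τ hσ) (hw' τ)
            _ = _ := by rw [← sum_mul, hsum', one_mul]

/-- Shift mass `ε` from the entries `(j, k)` and `(j', k')` to `(j', k)` and `(j, k')`. -/
def exchange {p : ℕ} (M : Fin p → Fin p → ℝ) (j j' k k' : Fin p) (ε : ℝ) :
    Fin p → Fin p → ℝ :=
  fun b l => M b l + ε * ((Pi.single j' 1 - Pi.single j 1 : Fin p → ℝ) b *
    (Pi.single k 1 - Pi.single k' 1 : Fin p → ℝ) l)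

lemma DoublyStochastic.exchange {p : ℕ} {M : Fin p → Fin p → ℝ} (hM : DoublyStochastic M)
    {j j' k k' : Fin p} (hj : j ≠ j') (hk : k ≠ k') {ε : ℝ} (hε : 0 ≤ ε)
    (h : ε ≤ M j k) (h' : ε ≤ M j' k') : DoublyStochastic (exchange M j j' k k' ε) := by
  obtain ⟨h0, hr, hc⟩ := hM
  refine ⟨fun b l => ?_, fun b => ?_, fun l => ?_⟩
  · have := h0 b l
    simp only [_root_.exchange, Pi.sub_apply, Pi.single_apply]
    split_ifs <;> subst_vars <;> first | contradiction | linarith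
  · simp only [_root_.exchange, sum_add_distrib, ← mul_sum, hr]
    simp
  · simp only [_root_.exchange, sum_add_distrib, ← mul_sum, ← sum_mul, hc]
    simp

lemma rankValue_exchange {p : ℕ} (M : Fin p → Fin p → ℝ) (j j' k k' : Fin p) (ε : ℝ)
    (a v : Fin p → ℝ) :
    rankValue (exchange M j j' k k' ε) a v =
      rankValue M a v + ε * ((a j' - a j) * (v k - v k')) := by
  have ha : ∑ b, (Pi.single j' 1 - Pi.single j 1 : Fin p → ℝ) b * a b = a j' - a j := by
    simp [sub_mul, Pi.single_apply]
  have hv : ∑ l, (Pi.single k 1 - Pi.single k' 1 : Fin p → ℝ) l * v l = v k - v k' := by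
    simp [sub_mul, Pi.single_apply]
  rw [← ha, ← hv, sum_mul_sum, mul_sum]
  simp only [rankValue, exchange, mul_sum, ← sum_add_distrib]
  exact sum_congr rfl fun b _ => sum_congr rfl fun l _ => by ring

lemma dotAV_eq_sum_rankValue {m p : ℕ} (P : Fin m → Fin p → Fin p → ℝ)
    (A : Fin m → Fin p → ℝ) (v : Fin p → ℝ) :
    dotAV P A v = ∑ i, rankValue (P i) (A i) v := rfl

/-- Replacing the ranking of one user cannot improve a maximizer over all ranking tensors. -/
lemma rankValue_le_of_forall_dotAV_le {m p : ℕ} {P : Fin m → Fin p → Fin p → ℝ}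
    {A : Fin m → Fin p → ℝ} {v : Fin p → ℝ} (hP : P ∈ RankingTensors m p)
    (hmax : ∀ P' ∈ RankingTensors m p, dotAV P' A v ≤ dotAV P A v) (i : Fin m)
    {M : Fin p → Fin p → ℝ} (hM : DoublyStochastic M) :
    rankValue M (A i) v ≤ rankValue (P i) (A i) v := by
  have h := hmax (Function.update P i M) fun i' => by
    rcases eq_or_ne i' i with rfl | hi
    · simpa using hM
    · simpa [hi] using hP i'
  rw [dotAV_eq_sum_rankValue, dotAV_eq_sum_rankValue, ← add_sum_erase _ _ (mem_univ i),
    ← add_sum_erase _ (fun i => rankValue (P i) (A i) v) (mem_univ i)] at h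
  have hrest : ∑ i' ∈ univ.erase i, rankValue (Function.update P i M i') (A i') v =
      ∑ i' ∈ univ.erase i, rankValue (P i') (A i') v :=
    sum_congr rfl fun i' hi' => by rw [Function.update_of_ne (ne_of_mem_erase hi')]
  rw [hrest, Function.update_self] at h
  linarith

/-- ranking rearrangement lemma: with nonincreasing nonnegative
exposure weights `v` whose positive entries are exactly those of (0-based) index
`< K`, any ranking tensor sorting each row of `A` in nonincreasing order on the
exposed positions maximizes `⟨·, X⟩` over `𝒫`; conversely, if `v` is strictly
decreasing, every maximizer sorts each row of `A` in nonincreasing order. -/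
theorem ranking_rearrangement (m p : ℕ) (A : Fin m → Fin p → ℝ) (v : Fin p → ℝ)
    (hv0 : ∀ k, 0 ≤ v k) (hvmono : ∀ k l : Fin p, k ≤ l → v l ≤ v k)
    (K : ℕ) (hK : ∀ k : Fin p, 0 < v k ↔ (k : ℕ) < K) :
    (∀ P ∈ RankingTensors m p,
      (∀ (i : Fin m) (σ : Equiv.Perm (Fin p)), InSupport (P i) σ →
        ∀ j j' : Fin p, (σ j : ℕ) < K → σ j < σ j' → A i j' ≤ A i j) →
      ∀ P' ∈ RankingTensors m p, dotAV P' A v ≤ dotAV P A v) ∧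
    ((∀ k l : Fin p, k < l → v l < v k) →
      ∀ P ∈ RankingTensors m p,
      (∀ P' ∈ RankingTensors m p, dotAV P' A v ≤ dotAV P A v) →
      ∀ (i : Fin m) (σ : Equiv.Perm (Fin p)), InSupport (P i) σ →
        ∀ j j' : Fin p, σ j < σ j' → A i j' ≤ A i j) := by
  refine ⟨fun P hP hsort P' hP' => sum_le_sum fun i _ => ?_, fun hv P hP hmax i σ hσ j j' hlt => ?_⟩
  · refine rankValue_le_of_forall_monovary (hP i) (hP' i) fun σ hσ j' j hvlt => ?_
    refine hsort i σ hσ j j' ((hK _).1 ((hv0 _).trans_lt hvlt)) ?_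
    by_contra! hle
    exact (hvmono _ _ hle).not_gt hvlt
  · by_contra! hA
    have hε : 0 < min (P i j (σ j)) (P i j' (σ j')) := lt_min (hσ j) (hσ j')
    have hjj' : j ≠ j' := fun h => hlt.ne (congrArg σ h)
    have h := rankValue_le_of_forall_dotAV_le hP hmax i
      ((hP i).exchange hjj' hlt.ne hε.le (min_le_left _ _) (min_le_right _ _))
    rw [rankValue_exchange] at h
    have := mul_pos hε (mul_pos (sub_pos.2 hA) (sub_pos.2 (hv _ _ hlt)))
    linarith
end

section
/- (Lemma: two-sided utilitarian ranking) Consider a one-sided recommendation setting with two-sided preferences μ_{ij} ≥ 0 for all i,j ∈ {1,…,n}, and let μ̃_{ij} = μ_{ij} + μ_{ji}. Assume v_k ≥ v_{k+1} ≥ 0 for all k. If P* ∈ 𝒫 is such that for every user i, every σ ∈ 𝔖(P*_i), and all items j, j', σ(j) < σ(j') implies μ̃_{ij} ≥ μ̃_{ij'}, then P* maximizes the total two-sided utility ∑_{i=1}^n u_i(P) over P ∈ 𝒫. Moreover, if v_k > v_{k+1} ≥ 0 for all k, the converse holds: every maximizer P* of ∑_{i=1}^n u_i(P) over 𝒫 satisfies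 this sorting condition on all supported rankings. -/
/-- Index type for the `n = m + p` entities: users `𝒩` (left) and items `ℐ` (right). -/
abbrev Idx (m p : ℕ) := Fin m ⊕ Fin p

/-- Extension of a ranking tensor with zero entries outside `𝒩 × ℐ`. -/
def Pfull {m p : ℕ} (P : Fin m → Fin p → Fin p → ℝ) :
    Idx m p → Idx m p → Fin p → ℝ :=
  fun x y k =>
    match x, y with
    | Sum.inl i, Sum.inr j => P i j k
    | _, _ => 0

/-- Two-sided utility `u_x(P) = ∑_y μ_{xy} ∑_k (P_{xyk} + P_{yxk}) v_k`. -/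
def util2 {m p : ℕ} (μ : Idx m p → Idx m p → ℝ) (v : Fin p → ℝ)
    (P : Fin m → Fin p → Fin p → ℝ) (x : Idx m p) : ℝ :=
  ∑ y, μ x y * ∑ k, (Pfull P x y k + Pfull P y x k) * v k

/-- The value `∑ j k, w j * M j k * v k` of a stochastic ranking `M` for item weights `w` and
exposure weights `v`. -/
def rankingValue {p : ℕ} (w v : Fin p → ℝ) (M : Fin p → Fin p → ℝ) : ℝ :=
  ∑ j, w j * ∑ k, M j k * v k

lemma sum_util2_eq {m p : ℕ} (μ : Idx m p → Idx m p → ℝ) (v : Fin p → ℝ)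
    (P : Fin m → Fin p → Fin p → ℝ) :
    ∑ x, util2 μ v P x =
      ∑ i, rankingValue (fun j => μ (Sum.inl i) (Sum.inr j) + μ (Sum.inr j) (Sum.inl i)) v
        (P i) := by
  simp only [util2, Pfull, rankingValue, Fintype.sum_sum_type, add_zero, zero_add, zero_mul,
    Finset.sum_const_zero, mul_zero, add_mul, Finset.sum_add_distrib]
  rw [add_comm]
  exact congrArg _ Finset.sum_comm

lemma rankingValue_sum_smul_perm {p : ℕ} (w v : Fin p → ℝ) (c : Equiv.Perm (Fin p) → ℝ) :
    rankingValue w v (fun j k => ∑ σ, c σ * if σ j = k then 1 else 0) =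
      ∑ σ, c σ * ∑ j, w j * v (σ j) := by
  have hrow : ∀ j, ∑ k, (∑ σ, c σ * if σ j = k then 1 else 0) * v k = ∑ σ, c σ * v (σ j) := by
    intro j
    simp_rw [Finset.sum_mul]
    rw [Finset.sum_comm]
    simp
  simp only [rankingValue, hrow, Finset.mul_sum]
  rw [Finset.sum_comm]
  exact Finset.sum_congr rfl fun _ _ => Finset.sum_congr rfl fun _ _ => mul_left_comm _ _ _

/-- Birkhoff's theorem for ranking matrices. -/
lemma DoublyStochastic.exists_eq_sum_perm {p : ℕ} {M : Fin p → Fin p → ℝ}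
    (hM : DoublyStochastic M) :
    ∃ c : Equiv.Perm (Fin p) → ℝ, (∀ σ, 0 ≤ c σ) ∧ ∑ σ, c σ = 1 ∧
      M = fun j k => ∑ σ, c σ * if σ j = k then 1 else 0 := by
  obtain ⟨c, hc0, hc1, hc⟩ := exists_eq_sum_perm_of_mem_doublyStochastic
    (M := (Matrix.of M : Matrix (Fin p) (Fin p) ℝ))
    (mem_doublyStochastic_iff_sum.2 ⟨hM.1, hM.2.1, hM.2.2⟩)
  refine ⟨c, hc0, hc1, ?_⟩
  funext j k
  have h := congrFun (congrFun hc j) k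
  rw [Matrix.sum_apply] at h
  simpa [Equiv.Perm.permMatrix, PEquiv.toMatrix_apply, Equiv.toPEquiv_apply, eq_comm] using h.symm

lemma sum_mul_comp_perm_le_of_sorted {p : ℕ} {w v : Fin p → ℝ} (hv : Antitone v)
    {σ : Equiv.Perm (Fin p)} (hσ : ∀ j j', σ j < σ j' → w j' ≤ w j) (τ : Equiv.Perm (Fin p)) :
    ∑ j, w j * v (τ j) ≤ ∑ j, w j * v (σ j) := by
  have hmono : Monovary w (v ∘ σ) := fun j j' h =>
    hσ j' j (lt_of_not_ge fun h' => absurd (hv h') (not_le.2 h))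
  simpa using hmono.sum_mul_comp_perm_le_sum_mul (σ := τ.trans σ.symm)

lemma rankingValue_le_of_sorted {p : ℕ} {w v : Fin p → ℝ} (hv : Antitone v)
    {M N : Fin p → Fin p → ℝ} (hM : DoublyStochastic M) (hN : DoublyStochastic N)
    (hsort : ∀ σ, InSupport M σ → ∀ j j', σ j < σ j' → w j' ≤ w j) :
    rankingValue w v N ≤ rankingValue w v M := by
  obtain ⟨c, hc0, hc1, hc⟩ := hM.exists_eq_sum_perm
  obtain ⟨d, hd0, hd1, hd⟩ := hN.exists_eq_sum_perm
  have hsupp : ∀ σ, 0 < c σ → InSupport M σ := fun σ hσ j => by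
    rw [hc]
    refine Finset.sum_pos' (fun τ _ => mul_nonneg (hc0 τ) ?_) ⟨σ, Finset.mem_univ σ, by simpa⟩
    split_ifs <;> norm_num
  have hle : ∀ σ τ, c σ * (d τ * ∑ j, w j * v (τ j)) ≤ c σ * (d τ * ∑ j, w j * v (σ j)) := by
    intro σ τ
    rcases (hc0 σ).eq_or_lt with h | h
    · simp [← h]
    · exact mul_le_mul_of_nonneg_left (mul_le_mul_of_nonneg_left
        (sum_mul_comp_perm_le_of_sorted hv (hsort σ (hsupp σ h)) τ) (hd0 τ)) h.le
  calc rankingValue w v N = ∑ τ, d τ * ∑ j, w j * v (τ j) := by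
        rw [hd, rankingValue_sum_smul_perm]
    _ = ∑ σ, ∑ τ, c σ * (d τ * ∑ j, w j * v (τ j)) := by
        simp_rw [← Finset.mul_sum]
        rw [← Finset.sum_mul, hc1, one_mul]
    _ ≤ ∑ σ, ∑ τ, c σ * (d τ * ∑ j, w j * v (σ j)) :=
        Finset.sum_le_sum fun σ _ => Finset.sum_le_sum fun τ _ => hle σ τ
    _ = ∑ σ, c σ * ∑ j, w j * v (σ j) := by
        simp_rw [← Finset.mul_sum, ← Finset.sum_mul, hd1, one_mul]
    _ = rankingValue w v M := by rw [hc, rankingValue_sum_smul_perm]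

/-- Move mass `ε` from the ranking `σ` to the ranking `τ`. -/
def shiftMass {p : ℕ} (M : Fin p → Fin p → ℝ) (ε : ℝ) (σ τ : Equiv.Perm (Fin p)) :
    Fin p → Fin p → ℝ :=
  fun j k => M j k - (if σ j = k then ε else 0) + if τ j = k then ε else 0

lemma DoublyStochastic.shiftMass {p : ℕ} {M : Fin p → Fin p → ℝ} (hM : DoublyStochastic M)
    {ε : ℝ} (hε : 0 ≤ ε) {σ : Equiv.Perm (Fin p)} (hσ : ∀ j, ε ≤ M j (σ j))
    (τ : Equiv.Perm (Fin p)) : DoublyStochastic (shiftMass M ε σ τ) := by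
  have hcol : ∀ (ρ : Equiv.Perm (Fin p)) (k : Fin p), ∑ j, (if ρ j = k then ε else 0) = ε :=
    fun ρ k => by simp [← Equiv.eq_symm_apply]
  refine ⟨fun j k => add_nonneg ?_ ?_, fun j => ?_, fun k => ?_⟩
  · split_ifs with h
    · exact sub_nonneg.2 (h ▸ hσ j)
    · simpa using hM.1 j k
  · split_ifs <;> simp [hε]
  · simp [_root_.shiftMass, Finset.sum_add_distrib, Finset.sum_sub_distrib, hM.2.1 j]
  · simp only [_root_.shiftMass, Finset.sum_add_distrib, Finset.sum_sub_distrib, hM.2.2 k, hcol]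
    ring

lemma rankingValue_shiftMass {p : ℕ} (w v : Fin p → ℝ) (M : Fin p → Fin p → ℝ) (ε : ℝ)
    (σ τ : Equiv.Perm (Fin p)) :
    rankingValue w v (shiftMass M ε σ τ) =
      rankingValue w v M + ε * ∑ j, w j * (v (τ j) - v (σ j)) := by
  unfold rankingValue
  rw [Finset.mul_sum _ _ ε, ← Finset.sum_add_distrib]
  refine Finset.sum_congr rfl fun j _ => ?_
  simp only [shiftMass, add_mul, sub_mul, Finset.sum_add_distrib, Finset.sum_sub_distrib, ite_mul, zero_mul,
    Finset.sum_ite_eq, Finset.mem_univ, if_true]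
  ring

lemma sum_mul_swap_sub {p : ℕ} (w f : Fin p → ℝ) {j j' : Fin p} (h : j ≠ j') :
    ∑ a, w a * (f (Equiv.swap j j' a) - f a) = (w j' - w j) * (f j - f j') := by
  rw [Finset.sum_eq_add j j' h (fun a _ ha => by
    simp [Equiv.swap_apply_of_ne_of_ne ha.1 ha.2]) (by simp) (by simp)]
  simp only [Equiv.swap_apply_left, Equiv.swap_apply_right]
  ring

lemma sorted_of_rankingValue_max {p : ℕ} {w v : Fin p → ℝ} (hv : StrictAnti v)
    {M : Fin p → Fin p → ℝ} (hM : DoublyStochastic M)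
    (hmax : ∀ N, DoublyStochastic N → rankingValue w v N ≤ rankingValue w v M)
    {σ : Equiv.Perm (Fin p)} (hσ : InSupport M σ) {j j' : Fin p} (hj : σ j < σ j') :
    w j' ≤ w j := by
  by_contra! hlt
  have hne : j ≠ j' := fun h => hj.ne (congrArg σ h)
  have : Nonempty (Fin p) := ⟨j⟩
  obtain ⟨a, ha⟩ := Finite.exists_min fun a => M a (σ a)
  have h := hmax _ (hM.shiftMass (hσ a).le ha ((Equiv.swap j j').trans σ))
  rw [rankingValue_shiftMass] at h
  have hsum := sum_mul_swap_sub w (v ∘ σ) hne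
  simp only [Function.comp_apply] at hsum
  simp only [Equiv.trans_apply, hsum] at h
  have := mul_pos (hσ a) (mul_pos (sub_pos.2 hlt) (sub_pos.2 (hv hj)))
  linarith

/-- two-sided utilitarian ranking: with nonincreasing nonnegative
exposure weights, a ranking tensor sorting, for each user `i`, the items by
nonincreasing `μ̃_{ij} = μ_{ij} + μ_{ji}` maximizes the total two-sided utility;
with strictly decreasing weights, the converse holds. -/
theorem utilitarian_two_sided (m p : ℕ)
    (μ : Idx m p → Idx m p → ℝ) (hμ : ∀ x y, 0 ≤ μ x y)
    (v : Fin p → ℝ) (hv0 : ∀ k, 0 ≤ v k) (hvmono : ∀ k l : Fin p, k ≤ l → v l ≤ v k) :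
    (∀ Pstar ∈ RankingTensors m p,
      (∀ (i : Fin m) (σ : Equiv.Perm (Fin p)), InSupport (Pstar i) σ →
        ∀ j j' : Fin p, σ j < σ j' →
          μ (Sum.inl i) (Sum.inr j') + μ (Sum.inr j') (Sum.inl i) ≤
            μ (Sum.inl i) (Sum.inr j) + μ (Sum.inr j) (Sum.inl i)) →
      ∀ P ∈ RankingTensors m p, ∑ x, util2 μ v P x ≤ ∑ x, util2 μ v Pstar x) ∧
    ((∀ k l : Fin p, k < l → v l < v k) →
      ∀ Pstar ∈ RankingTensors m p,
      (∀ P ∈ RankingTensors m p, ∑ x, util2 μ v P x ≤ ∑ x, util2 μ v Pstar x) →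
      ∀ (i : Fin m) (σ : Equiv.Perm (Fin p)), InSupport (Pstar i) σ →
        ∀ j j' : Fin p, σ j < σ j' →
          μ (Sum.inl i) (Sum.inr j') + μ (Sum.inr j') (Sum.inl i) ≤
            μ (Sum.inl i) (Sum.inr j) + μ (Sum.inr j) (Sum.inl i)) := by
  refine ⟨fun Q hQ hsort P hP => ?_, fun hv Q hQ hmax i σ hσ j j' hj => ?_⟩
  · rw [sum_util2_eq, sum_util2_eq]
    exact Finset.sum_le_sum fun i _ => rankingValue_le_of_sorted hvmono (hQ i) (hP i) (hsort i)
  · refine sorted_of_rankingValue_max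
      (w := fun j => μ (Sum.inl i) (Sum.inr j) + μ (Sum.inr j) (Sum.inl i)) hv (hQ i)
      (fun N hN => ?_) hσ hj
    have hmem : Function.update Q i N ∈ RankingTensors m p := fun i' => by
      rcases eq_or_ne i' i with rfl | h
      · simpa using hN
      · simpa [h] using hQ i'
    have h := hmax _ hmem
    rw [sum_util2_eq, sum_util2_eq, ← Finset.add_sum_erase _ _ (Finset.mem_univ i),
      ← Finset.add_sum_erase _ _ (Finset.mem_univ i), Function.update_self] at h
    rw [Finset.sum_congr rfl fun i' hi' => by
      rw [Function.update_of_ne (Finset.ne_of_mem_erase hi')]] at h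
    exact le_of_add_le_add_right h
end

section
/- (Theorem: excess risk bound for welfare maximization with estimated preferences) Let α ≤ 1 and θ = (1/2, α, α), so that W_θ(u) = (1/2)∑_{i=1}^n ψ(u_i,α). Consider a one-sided recommendation setting with two-sided preferences μ_{ij} ≥ 0 and estimated two-sided preferences μ̂_{ij} ≥ 0 that agree with μ on all entries outside 𝒩×ℐ (i.e., μ̂_{ij} and μ_{ij} may differ only for (i,j) ∈ 𝒩×ℐ). Let u(P) (resp. û(P)) denote the two-sided utility profile of P under μ (resp. μ̂). Let P̂ ∈ argmax_{P∈𝒫} W_θ(û(P)) and P* ∈ argmax_{P∈𝒫} W_θ(u(P)), and assume all coordinates of u(P̂), û(P̂), u(P*) and û(P*) are positive. Let B(μ̂) = max( max_{i∈{1,…,n}} ψ'(u_i(P̂), α), max_{i∈{1,…,n}} ψ'(û_i(P*), α) ), where ψ'(·,α) is the derivative of x ↦ ψ(x,α) on (0,∞). Then W_θ(u(P*)) − W_θ(u(P̂)) ≤ 4 B(μ̂) √(n‖v‖₂²) · √( ∑_{(i,j)∈𝒩×ℐ} (μ̂_{ij} − μ_{ij})² ). -/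
/-- `ψ(x, α)`, real-valued version (intended for `x > 0`). -/
noncomputable def psiR (x α : ℝ) : ℝ :=
  if 0 < α then x ^ α else if α = 0 then Real.log x else -(x ^ α)

theorem exists_hasDerivAt_psiR (α : ℝ) :
    ∃ c : ℝ, 0 ≤ c ∧ ∀ x : ℝ, 0 < x → HasDerivAt (fun y => psiR y α) (c * x ^ (α - 1)) x := by
  rcases lt_trichotomy α 0 with h | h | h
  · refine ⟨-α, by linarith, fun x hx => ?_⟩
    have := (Real.hasDerivAt_rpow_const (p := α) (Or.inl hx.ne')).neg
    simp only [psiR, if_neg h.not_gt, if_neg h.ne]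
    rw [neg_mul]
    exact this
  · refine ⟨1, zero_le_one, fun x hx => ?_⟩
    simpa [psiR, h, Real.rpow_neg_one] using Real.hasDerivAt_log hx.ne'
  · refine ⟨α, h.le, fun x hx => ?_⟩
    simpa only [psiR, if_pos h] using Real.hasDerivAt_rpow_const (p := α) (Or.inl hx.ne')

theorem deriv_psiR_nonneg (α : ℝ) {x : ℝ} (hx : 0 < x) : 0 ≤ deriv (fun y => psiR y α) x := by
  obtain ⟨c, hc, h⟩ := exists_hasDerivAt_psiR α
  rw [(h x hx).deriv]
  positivity

theorem differentiableAt_psiR (α : ℝ) {x : ℝ} (hx : 0 < x) :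
    DifferentiableAt ℝ (fun y => psiR y α) x :=
  let ⟨_, _, h⟩ := exists_hasDerivAt_psiR α
  (h x hx).differentiableAt

theorem concaveOn_psiR {α : ℝ} (hα : α ≤ 1) :
    ConcaveOn ℝ (Set.Ioi 0) (fun y => psiR y α) := by
  obtain ⟨c, hc, h⟩ := exists_hasDerivAt_psiR α
  refine AntitoneOn.concaveOn_of_deriv (convex_Ioi 0)
    (fun x hx => (differentiableAt_psiR α hx).continuousAt.continuousWithinAt) ?_ ?_
  · rw [interior_Ioi]
    exact fun x hx => (differentiableAt_psiR α hx).differentiableWithinAt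
  · rw [interior_Ioi]
    intro x hx y hy hxy
    rw [(h x hx).deriv, (h y hy).deriv]
    exact mul_le_mul_of_nonneg_left
      (Real.rpow_le_rpow_of_nonpos hx hxy (by linarith)) hc

/-- Concavity and monotonicity of `ψ(·, α)` control its increments by a bound on the derivative
at the base point. -/
theorem psiR_sub_le {α B a b : ℝ} (hα : α ≤ 1) (ha : 0 < a) (hb : 0 < b)
    (hB : deriv (fun y => psiR y α) a ≤ B) :
    psiR b α - psiR a α ≤ B * |b - a| := by
  have hd := deriv_psiR_nonneg α ha
  have hconc := concaveOn_psiR hα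
  have tangent : psiR b α - psiR a α ≤ deriv (fun y => psiR y α) a * (b - a) := by
    rcases lt_trichotomy a b with h | rfl | h
    · have := hconc.slope_le_deriv ha hb h (differentiableAt_psiR α ha)
      rwa [slope_def_field, div_le_iff₀ (sub_pos.2 h)] at this
    · simp
    · have := hconc.deriv_le_slope hb ha h (differentiableAt_psiR α ha)
      rw [slope_def_field, le_div_iff₀ (sub_pos.2 h)] at this
      linarith
  calc _ ≤ _ := tangent
    _ ≤ deriv (fun y => psiR y α) a * |b - a| := by gcongr; exact le_abs_self _
    _ ≤ B * |b - a| := by gcongr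

theorem sum_psiR_sub_le {ι : Type*} [Fintype ι] {α B : ℝ} (hα : α ≤ 1) {a b : ι → ℝ}
    (ha : ∀ x, 0 < a x) (hb : ∀ x, 0 < b x)
    (hB : ∀ x, deriv (fun y => psiR y α) (a x) ≤ B) :
    ∑ x, psiR (b x) α - ∑ x, psiR (a x) α ≤ B * ∑ x, |b x - a x| := by
  rw [← Finset.sum_sub_distrib, Finset.mul_sum]
  exact Finset.sum_le_sum fun x _ => psiR_sub_le hα (ha x) (hb x) (hB x)

theorem DoublyStochastic.sum_sq_exposure_le {p : ℕ} {M : Fin p → Fin p → ℝ}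
    (hM : DoublyStochastic M) (v : Fin p → ℝ) :
    ∑ j, (∑ k, M j k * v k) ^ 2 ≤ ∑ k, v k ^ 2 := by
  obtain ⟨h0, hrow, hcol⟩ := hM
  calc ∑ j, (∑ k, M j k * v k) ^ 2 ≤ ∑ j, ∑ k, M j k * v k ^ 2 :=
        Finset.sum_le_sum fun j _ => Real.pow_arith_mean_le_arith_mean_pow_of_even _ _ _
          (fun k _ => h0 j k) (hrow j) even_two
    _ = ∑ k, v k ^ 2 := by
        rw [Finset.sum_comm]
        simp [← Finset.sum_mul, hcol]

theorem util2_inl {m p : ℕ} (μ : Idx m p → Idx m p → ℝ) (v : Fin p → ℝ)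
    (P : Fin m → Fin p → Fin p → ℝ) (i : Fin m) :
    util2 μ v P (Sum.inl i) =
      ∑ j, μ (Sum.inl i) (Sum.inr j) * ∑ k, P i j k * v k := by
  simp [util2, Pfull]

theorem util2_inr {m p : ℕ} (μ : Idx m p → Idx m p → ℝ) (v : Fin p → ℝ)
    (P : Fin m → Fin p → Fin p → ℝ) (j : Fin p) :
    util2 μ v P (Sum.inr j) =
      ∑ i, μ (Sum.inr j) (Sum.inl i) * ∑ k, P i j k * v k := by
  simp [util2, Pfull]

/-- Total change in utilities when only the user–item preferences are perturbed. -/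
theorem sum_abs_util2_sub_le {m p : ℕ} {μ μhat : Idx m p → Idx m p → ℝ}
    (hagree : ∀ (j : Fin p) (i : Fin m), μhat (Sum.inr j) (Sum.inl i) = μ (Sum.inr j) (Sum.inl i))
    (v : Fin p → ℝ) {P : Fin m → Fin p → Fin p → ℝ} (hP : P ∈ RankingTensors m p) :
    ∑ x, |util2 μhat v P x - util2 μ v P x| ≤
      Real.sqrt (((m : ℝ) + (p : ℝ)) * ∑ k, (v k) ^ 2) *
        Real.sqrt (∑ i : Fin m, ∑ j : Fin p,
          (μhat (Sum.inl i) (Sum.inr j) - μ (Sum.inl i) (Sum.inr j)) ^ 2) := by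
  set e : Fin m × Fin p → ℝ := fun q => |∑ k, P q.1 q.2 k * v k| with he
  set d : Fin m × Fin p → ℝ := fun q =>
    |μhat (Sum.inl q.1) (Sum.inr q.2) - μ (Sum.inl q.1) (Sum.inr q.2)| with hd
  have hexp : ∑ q, e q ^ 2 ≤ ((m : ℝ) + p) * ∑ k, v k ^ 2 := by
    have hv : 0 ≤ ∑ k, v k ^ 2 := Finset.sum_nonneg fun k _ => sq_nonneg _
    calc ∑ q, e q ^ 2 = ∑ i, ∑ j, (∑ k, P i j k * v k) ^ 2 := by
          simp only [he, sq_abs, Fintype.sum_prod_type]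
      _ ≤ ∑ _i : Fin m, ∑ k, v k ^ 2 :=
          Finset.sum_le_sum fun i _ => (hP i).sum_sq_exposure_le v
      _ = m * ∑ k, v k ^ 2 := by simp
      _ ≤ _ := by gcongr; simp
  calc ∑ x, |util2 μhat v P x - util2 μ v P x|
      = ∑ i, |∑ j, (μhat (Sum.inl i) (Sum.inr j) - μ (Sum.inl i) (Sum.inr j)) *
          ∑ k, P i j k * v k| := by
        simp [Fintype.sum_sum_type, util2_inl, util2_inr, hagree, sub_mul]
    _ ≤ ∑ i, ∑ j, e (i, j) * d (i, j) := by
        refine Finset.sum_le_sum fun i _ => (Finset.abs_sum_le_sum_abs _ _).trans_eq ?_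
        simp only [he, hd, abs_mul, mul_comm]
    _ = ∑ q, e q * d q := by rw [Fintype.sum_prod_type]
    _ ≤ √(∑ q, e q ^ 2) * √(∑ q, d q ^ 2) := Real.sum_mul_le_sqrt_mul_sqrt _ _ _
    _ ≤ _ := by
        have : ∑ q, d q ^ 2 = ∑ i : Fin m, ∑ j : Fin p,
            (μhat (Sum.inl i) (Sum.inr j) - μ (Sum.inl i) (Sum.inr j)) ^ 2 := by
          simp only [hd, sq_abs, Fintype.sum_prod_type]
        rw [this]
        gcongr

/-- excess risk bound: for `θ = (1/2, α, α)` with `α ≤ 1`, the loss in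
true welfare incurred by maximizing the welfare of estimated preferences is bounded
by `4 B(μ̂) √(n ‖v‖₂²) ‖μ̂ - μ‖_F` (Frobenius norm over the user–item entries). -/
theorem excess_risk_bound (m p : ℕ) (α : ℝ) (hα : α ≤ 1)
    (μ μhat : Idx m p → Idx m p → ℝ)
    (hμ : ∀ x y, 0 ≤ μ x y) (hμhat : ∀ x y, 0 ≤ μhat x y)
    (hagree : ∀ x y : Idx m p,
      (∀ (i : Fin m) (j : Fin p), ¬(x = Sum.inl i ∧ y = Sum.inr j)) → μhat x y = μ x y)
    (v : Fin p → ℝ) (hv0 : ∀ k, 0 ≤ v k) (hvmono : ∀ k l : Fin p, k ≤ l → v l ≤ v k)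
    (Phat Pstar : Fin m → Fin p → Fin p → ℝ)
    (hPhat : Phat ∈ RankingTensors m p) (hPstar : Pstar ∈ RankingTensors m p)
    (hPhatMax : ∀ P ∈ RankingTensors m p,
      (1 / 2 : ℝ) * ∑ x, psiR (util2 μhat v P x) α ≤
        (1 / 2 : ℝ) * ∑ x, psiR (util2 μhat v Phat x) α)
    (hPstarMax : ∀ P ∈ RankingTensors m p,
      (1 / 2 : ℝ) * ∑ x, psiR (util2 μ v P x) α ≤
        (1 / 2 : ℝ) * ∑ x, psiR (util2 μ v Pstar x) α)
    (hpos1 : ∀ x, 0 < util2 μ v Phat x) (hpos2 : ∀ x, 0 < util2 μhat v Phat x)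
    (hpos3 : ∀ x, 0 < util2 μ v Pstar x) (hpos4 : ∀ x, 0 < util2 μhat v Pstar x)
    (B : ℝ)
    (hB : ∀ x : Idx m p,
      deriv (fun y => psiR y α) (util2 μ v Phat x) ≤ B ∧
      deriv (fun y => psiR y α) (util2 μhat v Pstar x) ≤ B) :
    (1 / 2 : ℝ) * ∑ x, psiR (util2 μ v Pstar x) α -
        (1 / 2 : ℝ) * ∑ x, psiR (util2 μ v Phat x) α ≤
      4 * B * Real.sqrt (((m : ℝ) + (p : ℝ)) * ∑ k, (v k) ^ 2) *
        Real.sqrt (∑ i : Fin m, ∑ j : Fin p,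
          (μhat (Sum.inl i) (Sum.inr j) - μ (Sum.inl i) (Sum.inr j)) ^ 2) := by
  rcases isEmpty_or_nonempty (Idx m p) with hempty | ⟨⟨x₀⟩⟩
  · obtain ⟨hm, hp⟩ := isEmpty_sum.1 hempty
    simp
  have hB0 : 0 ≤ B := (deriv_psiR_nonneg α (hpos1 x₀)).trans (hB x₀).1
  have hag : ∀ (j : Fin p) (i : Fin m),
      μhat (Sum.inr j) (Sum.inl i) = μ (Sum.inr j) (Sum.inl i) :=
    fun j i => hagree _ _ (by simp)
  have hstar := sum_psiR_sub_le hα hpos4 hpos3 fun x => (hB x).2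
  have hhat := sum_psiR_sub_le hα hpos1 hpos2 fun x => (hB x).1
  have hmax := hPhatMax Pstar hPstar
  have hustar := mul_le_mul_of_nonneg_left (sum_abs_util2_sub_le hag v hPstar) hB0
  have huhat := mul_le_mul_of_nonneg_left (sum_abs_util2_sub_le hag v hPhat) hB0
  simp only [abs_sub_comm (util2 μ v Pstar _)] at hstar
  rw [mul_assoc, mul_assoc]
  set S := √(((m : ℝ) + p) * ∑ k, v k ^ 2) * √(∑ i : Fin m, ∑ j : Fin p,
    (μhat (Sum.inl i) (Sum.inr j) - μ (Sum.inl i) (Sum.inr j)) ^ 2)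
  have hBS : 0 ≤ B * S := by positivity
  linarith
end

section
/- (Proposition: item-side leximin in the limit) Consider a one-sided recommendation setting with feasible utility set 𝒰, and assume every u ∈ 𝒰 has all coordinates positive. Let 𝒰^item_lex = {u ∈ 𝒰 : for all u' ∈ 𝒰, u_ℐ ≥_lex u'_ℐ}. Fix α₁ < 1 and suppose u* ∈ 𝒰^item_lex maximizes ∑_{i∈𝒩} ψ(u_i, α₁) over 𝒰^item_lex. Then for every η > max(1, ‖u*_ℐ‖_∞) and every u ∈ 𝒰, there exists α₀ ∈ ℝ such that for all α ≤ α₀: W_{(1−η^α, α₁, α)}(u*) ≥ W_{(1−η^α, α₁, α)}(u). -/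
/-- Leximin (weak) order `u ≥_lex u'` on utility profiles, comparing the vectors of
cumulative sums of smallest coordinates lexicographically. -/
def LexGe {d : ℕ} (u u' : Fin d → ℝ) : Prop :=
  lorenz u = lorenz u' ∨
    ∃ k : Fin d, (∀ i < k, lorenz u i = lorenz u' i) ∧ lorenz u' k < lorenz u k

open Filter Topology in
/-- If `x` and `y` agree below `k`, `y k < x k`, and `x` is bounded below by `x k` above `k`, then
for exponents near `-∞` the power sum of `y` exceeds that of `x` by any fixed multiple of `η ^ α`. -/
lemma eventually_rpow_sum_gap {d : ℕ} (x y : Fin d → ℝ) (k : Fin d) (hx : Monotone x)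
    (hy : ∀ j, 0 < y j) (hlt : ∀ i < k, x i = y i) (hk : y k < x k)
    {η : ℝ} (hη1 : 1 < η) (hη : x k < η) (C : ℝ) :
    ∀ᶠ α : ℝ in atBot, η ^ α * C ≤ (1 - η ^ α) * (∑ j, y j ^ α - ∑ j, x j ^ α) := by
  have hyk := hy k
  have hxk : 0 < x k := hyk.trans hk
  have hη0 : 0 < η := hxk.trans hη
  have t1 : Tendsto (fun α : ℝ => η ^ α) atBot (𝓝 0) := tendsto_rpow_atBot_of_base_gt_one η hη1
  have t2 : Tendsto (fun α : ℝ => (x k / y k) ^ α) atBot (𝓝 0) :=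
    tendsto_rpow_atBot_of_base_gt_one _ ((one_lt_div hyk).2 hk)
  have t3 : Tendsto (fun α : ℝ => (η / y k) ^ α) atBot (𝓝 0) :=
    tendsto_rpow_atBot_of_base_gt_one _ ((one_lt_div hyk).2 (hk.trans hη))
  have t4 : Tendsto (fun α : ℝ => (1 - η ^ α) * (1 - d * (x k / y k) ^ α) - (η / y k) ^ α * C)
      atBot (𝓝 ((1 - 0) * (1 - d * 0) - 0 * C)) :=
    ((tendsto_const_nhds.sub t1).mul (tendsto_const_nhds.sub (t2.const_mul _))).sub
      (t3.mul_const _)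
  filter_upwards [t4.eventually (lt_mem_nhds (by norm_num : (0 : ℝ) < _)), eventually_lt_atBot 0]
    with α hα hneg
  have hηα : η ^ α < 1 := Real.rpow_lt_one_of_one_lt_of_neg hη1 hneg
  have hykα : 0 < y k ^ α := Real.rpow_pos_of_pos hyk α
  have term : ∀ j, (if j = k then y k ^ α else 0) - x k ^ α ≤ y j ^ α - x j ^ α := by
    intro j
    have hyj : 0 < y j ^ α := Real.rpow_pos_of_pos (hy j) α
    have hxkα : 0 < x k ^ α := Real.rpow_pos_of_pos hxk α
    rcases lt_trichotomy j k with h | rfl | h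
    · simp [h.ne, hlt j h, hxkα.le]
    · simp
    · have := Real.rpow_le_rpow_of_nonpos hxk (hx h.le) hneg.le
      simp only [h.ne', if_false]
      linarith
  have gap : y k ^ α - d * x k ^ α ≤ ∑ j, y j ^ α - ∑ j, x j ^ α := by
    simpa [Finset.sum_sub_distrib] using Finset.sum_le_sum fun j (_ : j ∈ Finset.univ) => term j
  refine le_trans ?_ (mul_le_mul_of_nonneg_left gap (by linarith))
  rw [Real.div_rpow hxk.le hyk.le, Real.div_rpow hη0.le hyk.le] at hα
  have key := mul_pos hykα hα
  have : y k ^ α * ((1 - η ^ α) * (1 - d * (x k ^ α / y k ^ α)) - η ^ α / y k ^ α * C)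
      = (1 - η ^ α) * (y k ^ α - d * x k ^ α) - η ^ α * C := by
    field_simp
  linarith

lemma lorenz_eq_sum_Iio_add {d : ℕ} (u : Fin d → ℝ) (i : Fin d) :
    lorenz u i = ∑ j ∈ Finset.Iio i, u (Tuple.sort u j) + u (Tuple.sort u i) := by
  rw [lorenz, ← Finset.Iio_insert, Finset.sum_insert (by simp), add_comm]

lemma sorted_eq_of_lorenz_eq {d : ℕ} {u w : Fin d → ℝ} (i : Fin d)
    (h : ∀ j ≤ i, lorenz u j = lorenz w j) : u (Tuple.sort u i) = w (Tuple.sort w i) := by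
  induction i using WellFoundedLT.induction with
  | ind i ih =>
    have hs : ∑ j ∈ Finset.Iio i, u (Tuple.sort u j) = ∑ j ∈ Finset.Iio i, w (Tuple.sort w j) :=
      Finset.sum_congr rfl fun j hj =>
        ih j (Finset.mem_Iio.1 hj) fun l hl => h l (hl.trans (Finset.mem_Iio.1 hj).le)
    have := h i le_rfl
    rw [lorenz_eq_sum_Iio_add, lorenz_eq_sum_Iio_add, hs] at this
    exact add_left_cancel this

lemma sum_comp_sort {d : ℕ} (u : Fin d → ℝ) (f : ℝ → ℝ) :
    ∑ j, f (u (Tuple.sort u j)) = ∑ j, f (u j) :=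
  Equiv.sum_comp (Tuple.sort u) fun j => f (u j)

lemma sum_eq_of_lorenz_eq {d : ℕ} {u w : Fin d → ℝ} (h : lorenz u = lorenz w) (f : ℝ → ℝ) :
    ∑ j, f (u j) = ∑ j, f (w j) := by
  rw [← sum_comp_sort u, ← sum_comp_sort w]
  exact Finset.sum_congr rfl fun j _ => by rw [sorted_eq_of_lorenz_eq j fun l _ => congrFun h l]

lemma psiR_of_neg {α : ℝ} (hα : α < 0) (x : ℝ) : psiR x α = -(x ^ α) := by
  simp [psiR, hα.ne, hα.le]


/-- item-side leximin in the limit: if `u*` is item-side leximin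
optimal and maximizes the user-side welfare `∑_{i∈𝒩} ψ(u_i, α₁)` among item-side
leximin optimal profiles, then for every `η > max(1, ‖u*_ℐ‖_∞)` and every feasible
profile `u`, for all sufficiently small `α` one has
`W_{(1-η^α, α₁, α)}(u*) ≥ W_{(1-η^α, α₁, α)}(u)`. -/
theorem item_side_leximin_limit (m p : ℕ)
    (v : Fin p → ℝ) (hv0 : ∀ k, 0 ≤ v k) (hvmono : ∀ k l : Fin p, k ≤ l → v l ≤ v k)
    (μ : Fin m → Fin p → ℝ) (hμ : ∀ i j, 0 ≤ μ i j)
    (hposN : ∀ P ∈ RankingTensors m p, ∀ i, 0 < userUtil μ v P i)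
    (hposI : ∀ P ∈ RankingTensors m p, ∀ j, 0 < itemUtil v P j)
    (a1 : ℝ) (ha1 : a1 < 1)
    (Pstar : Fin m → Fin p → Fin p → ℝ) (hPstar : Pstar ∈ RankingTensors m p)
    (hlex : ∀ P ∈ RankingTensors m p, LexGe (itemUtil v Pstar) (itemUtil v P))
    (hmax : ∀ P ∈ RankingTensors m p,
      (∀ P' ∈ RankingTensors m p, LexGe (itemUtil v P) (itemUtil v P')) →
      ∑ i, psiR (userUtil μ v P i) a1 ≤ ∑ i, psiR (userUtil μ v Pstar i) a1)
    (η : ℝ) (hη1 : 1 < η) (hη2 : ∀ j, itemUtil v Pstar j < η) :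
    ∀ P ∈ RankingTensors m p, ∃ α0 : ℝ, ∀ α : ℝ, α ≤ α0 →
      η ^ α * ∑ i, psiR (userUtil μ v P i) a1 +
          (1 - η ^ α) * ∑ j, psiR (itemUtil v P j) α ≤
        η ^ α * ∑ i, psiR (userUtil μ v Pstar i) a1 +
          (1 - η ^ α) * ∑ j, psiR (itemUtil v Pstar j) α := by
  intro P hP
  rcases hlex P hP with heq | ⟨k, hlt, hk⟩
  · refine ⟨0, fun α _ => ?_⟩
    have hle := hmax P hP fun P' hP' => by simpa only [LexGe, heq] using hlex P' hP'
    rw [sum_eq_of_lorenz_eq heq fun x => psiR x α]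
    gcongr
  · set u := itemUtil v Pstar
    set w := itemUtil v P
    have hagree : ∀ i < k, u (Tuple.sort u i) = w (Tuple.sort w i) := fun i hi =>
      sorted_eq_of_lorenz_eq i fun j hj => hlt j (hj.trans_lt hi)
    have hgap : w (Tuple.sort w k) < u (Tuple.sort u k) := by
      rw [lorenz_eq_sum_Iio_add, lorenz_eq_sum_Iio_add u,
        Finset.sum_congr rfl fun j hj => hagree j (Finset.mem_Iio.1 hj)] at hk
      exact lt_of_add_lt_add_left hk
    have hev := eventually_rpow_sum_gap (u ∘ Tuple.sort u) (w ∘ Tuple.sort w) k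
      (Tuple.monotone_sort u) (fun j => hposI P hP _) hagree hgap hη1 (hη2 _)
      (∑ i, psiR (userUtil μ v P i) a1 - ∑ i, psiR (userUtil μ v Pstar i) a1)
    obtain ⟨α0, h0⟩ := Filter.eventually_atBot.1 (hev.and (Filter.eventually_lt_atBot 0))
    refine ⟨α0, fun α hα => ?_⟩
    obtain ⟨h, hneg⟩ := h0 α hα
    simp only [Function.comp_apply] at h
    rw [sum_comp_sort w fun x => x ^ α, sum_comp_sort u fun x => x ^ α] at h
    simp only [psiR_of_neg hneg, Finset.sum_neg_distrib]
    linarith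
end
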